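/- arXiv:1707.03896 — 2 statements merged into one kernel-verified Lean document; each statement's English description precedes it below -/
import Mathlib

section
/- Let n ≥ 2, let q ≥ 3 be a prime power, let μ, λ ∈ 𝔽_q^× with μ ≠ λ and μ^{n−1}·λ = 1, and let y = diag(μ, …, μ, λ) ∈ G = SL_n(𝔽_q) (with μ occurring n−1 times). Let S = y^G be the conjugacy class of y. Then for every integer t with 1 ≤ t ≤ n − 1, ‖P^t − U‖₁ > 1/e; in particular the mixing time T(G, y) is at least n. -/
/-- The `t`-step distribution of the random walk on a finite group `G` driven by a
subset `S`: `P^t(g)` is the number of tuples `(s_1, …, s_t) ∈ S^t` with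
`s_1 ⋯ s_t = g`, divided by `|S|^t`. -/
noncomputable def walkProb {G : Type*} [Group G] [Fintype G]
    (S : Set G) (t : ℕ) (g : G) : ℝ :=
  (Nat.card {f : Fin t → G // (∀ i, f i ∈ S) ∧ (List.ofFn f).prod = g} : ℝ) /
    (Nat.card S : ℝ) ^ t

/-- The `l¹`-distance `‖P^t − U‖₁` between the `t`-step distribution of the random
walk driven by `S` and the uniform distribution `U` on `G`. -/
noncomputable def walkL1Dist {G : Type*} [Group G] [Fintype G]
    (S : Set G) (t : ℕ) : ℝ :=
  ∑ g : G, |walkProb S t g - 1 / (Fintype.card G : ℝ)|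

open scoped Matrix in
/-- `SL` moves a vector to any vector linearly independent of it. -/
theorem Matrix.SpecialLinearGroup.exists_smul_eq_of_linearIndependent {F ι : Type*} [Field F]
    [Fintype ι] [DecidableEq ι] {v w : ι → F} (h : LinearIndependent F ![v, w]) :
    ∃ g : SpecialLinearGroup ι F, g • v = w := by
  obtain ⟨f, hf⟩ := Module.exists_dual_forall_apply_eq_one h.linearIndepOn_univ
  have hv : f v = 1 := hf 0 trivial
  have hw : f w = 1 := hf 1 trivial
  refine ⟨⟨LinearMap.toMatrix' (LinearMap.transvection f (w - v)), ?_⟩, ?_⟩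
  · simp [hv, hw]
  · change (LinearMap.toMatrix' _) *ᵥ v = w
    rw [LinearMap.toMatrix'_mulVec, LinearMap.transvection.apply, hv]
    simp

/-- In dimension at least two, `SL` acts transitively on the nonzero vectors. -/
theorem Matrix.SpecialLinearGroup.exists_smul_eq {F ι : Type*} [Field F]
    [Fintype ι] [DecidableEq ι] (hι : 1 < Fintype.card ι) {v w : ι → F} (hv : v ≠ 0) (hw : w ≠ 0) :
    ∃ g : SpecialLinearGroup ι F, g • v = w := by
  by_cases h : LinearIndependent F ![v, w]
  · exact exists_smul_eq_of_linearIndependent h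
  · obtain ⟨u, hu⟩ := exists_linearIndependent_pair_of_one_lt_finrank (R := F) (by simpa) hv
    obtain ⟨a, rfl⟩ : ∃ a : F, a • v = w := by
      rw [LinearIndependent.pair_iff' hv] at h
      simpa using h
    have ha : a ≠ 0 := by rintro rfl; simp at hw
    have hu' : LinearIndependent F ![u, a • v] := by
      rw [LinearIndependent.pair_symm_iff, LinearIndependent.pair_iff' hw]
      rw [LinearIndependent.pair_iff' hv] at hu
      intro b
      rw [smul_smul]
      exact hu _
    obtain ⟨g, hg⟩ := exists_smul_eq_of_linearIndependent hu
    obtain ⟨k, hk⟩ := exists_smul_eq_of_linearIndependent hu'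
    exact ⟨k * g, by rw [mul_smul, hg, hk]⟩

/-- The pairs `(g, v)` with `v ≠ 0` and `g • v = a • v` are as numerous as the elements of `SL`. -/
theorem Matrix.SpecialLinearGroup.sum_card_smul_eq {F ι : Type*} [Field F] [Fintype F]
    [Fintype ι] [DecidableEq F] [DecidableEq ι] (hι : 1 < Fintype.card ι) {a : F} (ha : a ≠ 0) :
    ∑ v : {v : ι → F // v ≠ 0},
      Fintype.card {g : SpecialLinearGroup ι F // g • v.1 = a • v.1} =
      Fintype.card (SpecialLinearGroup ι F) := by
  have : Nonempty ι := Fintype.card_pos_iff.1 (by lia)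
  obtain ⟨v₀, hv₀⟩ := exists_ne (0 : ι → F)
  have key (v : {v : ι → F // v ≠ 0}) :
      Fintype.card {g : SpecialLinearGroup ι F // g • v.1 = a • v.1} =
      Fintype.card {g : SpecialLinearGroup ι F // g • v₀ = v.1} := by
    obtain ⟨h, hh⟩ := exists_smul_eq hι hv₀ v.2
    obtain ⟨k, hk⟩ := exists_smul_eq hι (smul_ne_zero ha v.2) v.2
    refine Fintype.card_congr (((Equiv.mulLeft k).trans (Equiv.mulRight h)).subtypeEquiv fun g => ?_)
    simp only [Equiv.trans_apply, Equiv.coe_mulLeft, Equiv.coe_mulRight, mul_smul, hh]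
    nth_rewrite 4 [← hk]
    exact (smul_left_cancel_iff k).symm
  simp_rw [key]
  rw [← Fintype.card_sigma]
  refine Fintype.card_congr (Equiv.sigmaFiberEquiv
    (fun g : SpecialLinearGroup ι F => (⟨g • v₀, (smul_ne_zero_iff_ne g).2 hv₀⟩ : {v : ι → F // v ≠ 0}))
    |>.symm.trans (Equiv.sigmaCongrRight fun v => Equiv.subtypeEquivRight fun g => ?_)).symm
  exact Subtype.ext_iff

/-- At most `1 / (q - 1)` of the elements of `SL` have a given nonzero eigenvalue. -/
theorem Matrix.SpecialLinearGroup.card_hasEigenvector_mul_le {F ι : Type*} [Field F] [Fintype F]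
    [Fintype ι] [DecidableEq F] [DecidableEq ι] (hι : 1 < Fintype.card ι) {a : F} (ha : a ≠ 0) :
    Fintype.card {g : SpecialLinearGroup ι F // ∃ v : ι → F, v ≠ 0 ∧ g • v = a • v} *
      (Fintype.card F - 1) ≤ Fintype.card (SpecialLinearGroup ι F) := by
  rw [← sum_card_smul_eq (F := F) hι ha, ← Fintype.card_sigma, ← Fintype.card_units,
    ← Fintype.card_prod]
  have hv (g : {g : SpecialLinearGroup ι F // ∃ v : ι → F, v ≠ 0 ∧ g • v = a • v}) := g.2
  choose v hv0 hv using hv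
  refine Fintype.card_le_of_injective (fun p => ⟨⟨(p.2 : F) • v p.1, smul_ne_zero p.2.ne_zero (hv0 _)⟩,
    ⟨p.1.1, ?_⟩⟩) ?_
  · rw [smul_comm, hv, smul_comm]
  · rintro ⟨g, b⟩ ⟨g', b'⟩ h
    obtain rfl : g = g' := by
      apply Subtype.ext
      exact congrArg (fun x : (Σ v : {v : ι → F // v ≠ 0},
        {g : SpecialLinearGroup ι F // g • v.1 = a • v.1}) => x.2.1) h
    have h1 := congrArg (fun x : (Σ v : {v : ι → F // v ≠ 0},
        {g : SpecialLinearGroup ι F // g • v.1 = a • v.1}) => x.1.1) h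
    simp only [Prod.mk.injEq, true_and]
    exact Units.ext (smul_left_injective F (hv0 g) h1)

theorem walkProb_eq_zero {G : Type*} [Group G] [Fintype G] {S : Set G} {t : ℕ} {g : G}
    (h : ∀ f : Fin t → G, (∀ i, f i ∈ S) → (List.ofFn f).prod ≠ g) : walkProb S t g = 0 := by
  have : IsEmpty {f : Fin t → G // (∀ i, f i ∈ S) ∧ (List.ofFn f).prod = g} :=
    ⟨fun f => h f.1 f.2.1 f.2.2⟩
  simp [walkProb]

/-- If `P^t` is supported on `A`, then `‖P^t − U‖₁` is at least `1 - |A| / |G|`. -/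
theorem le_walkL1Dist {G : Type*} [Group G] [Fintype G] (S : Set G) (t : ℕ) (A : Set G)
    (hA : ∀ g, g ∉ A → walkProb S t g = 0) :
    1 - (Nat.card A : ℝ) / Fintype.card G ≤ walkL1Dist S t := by
  classical
  have h0 : (0 : ℝ) < Fintype.card G := by exact_mod_cast Fintype.card_pos
  calc 1 - (Nat.card A : ℝ) / Fintype.card G
      = ∑ g ∈ (A.toFinset)ᶜ, 1 / (Fintype.card G : ℝ) := by
        rw [Finset.sum_const, Finset.card_compl, nsmul_eq_mul, Nat.cast_sub (Finset.card_le_univ _),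
          Set.toFinset_card, Nat.card_eq_fintype_card]
        field_simp
    _ ≤ ∑ g ∈ (A.toFinset)ᶜ, |walkProb S t g - 1 / (Fintype.card G : ℝ)| := by
        refine Finset.sum_le_sum fun g hg => ?_
        rw [hA g (by simpa using hg), zero_sub, abs_neg]
        exact le_abs_self _
    _ ≤ walkL1Dist S t :=
        Finset.sum_le_sum_of_subset_of_nonneg (Finset.subset_univ _) fun _ _ _ => abs_nonneg _

theorem list_prod_smul_eq {G F V : Type*} [Monoid G] [Field F] [AddCommGroup V] [Module F V]
    [DistribMulAction G V] [SMulCommClass G F V] {a : F} {v : V} (l : List G)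
    (h : ∀ s ∈ l, s • v = a • v) : l.prod • v = a ^ l.length • v := by
  induction l with
  | nil => simp
  | cons s l ih =>
    rw [List.prod_cons, mul_smul, ih fun x hx => h x (List.mem_cons_of_mem _ hx), smul_comm,
      h s List.mem_cons_self, smul_smul, List.length_cons, pow_succ]

/-- Lemma 5.2(ii). Let `n ≥ 2`, let `𝔽_q` be a finite field
with `q ≥ 3`, let `μ ≠ λ` in `𝔽_q^×` with `μ^{n−1}·λ = 1`, and let
`y = diag(μ, …, μ, λ) ∈ G = SL_n(𝔽_q)` (with `μ` occurring `n−1` times).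
Then for the random walk driven by the conjugacy class `S = y^G` and every
`1 ≤ t ≤ n − 1` we have `‖P^t − U‖₁ > 1/e`; in particular the mixing time
`T(G, y)` is at least `n`. -/
theorem mixing_time_lower_bound_homology {F : Type*} [Field F] [Fintype F]
    [DecidableEq F] (n : ℕ) (hn : 2 ≤ n) (hq : 3 ≤ Fintype.card F)
    (mu lam : Fˣ) (hne : (mu : F) ≠ (lam : F)) (hdet : (mu : F) ^ (n - 1) * lam = 1)
    (y : Matrix.SpecialLinearGroup (Fin n) F)
    (hy : (y : Matrix (Fin n) (Fin n) F) =
      Matrix.diagonal (fun i : Fin n => if (i : ℕ) = n - 1 then (lam : F) else (mu : F))) :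
    ∀ t : ℕ, 1 ≤ t → t ≤ n - 1 →
      1 / Real.exp 1 <
        walkL1Dist
          {x : Matrix.SpecialLinearGroup (Fin n) F | ∃ c, c * y * c⁻¹ = x} t := by
  intro t _ htn
  let A : Set (Matrix.SpecialLinearGroup (Fin n) F) := {g | ∃ v : Fin n → F, v ≠ 0 ∧ g • v = (mu : F) ^ t • v}
  have hcount : Nat.card A * 2 ≤ Fintype.card (Matrix.SpecialLinearGroup (Fin n) F) := by
    rw [Nat.card_eq_fintype_card]
    exact (Nat.mul_le_mul_left _ (by lia)).trans
      (Matrix.SpecialLinearGroup.card_hasEigenvector_mul_le (by simp; lia)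
        (pow_ne_zero t mu.ne_zero))
  have hsupp : ∀ g, g ∉ A → walkProb {x : Matrix.SpecialLinearGroup (Fin n) F | ∃ c, c * y * c⁻¹ = x} t g = 0 := by
    refine fun g hg => walkProb_eq_zero fun f hf hfg => hg ?_
    choose c hc using hf
    let φ : (Fin n → F) →ₗ[F] (Fin t → F) := LinearMap.pi fun i =>
      LinearMap.proj (⟨n - 1, by lia⟩ : Fin n) ∘ₗ DistribSMul.toLinearMap F (Fin n → F) (c i)⁻¹
    obtain ⟨v, hv, hv0⟩ := Submodule.exists_mem_ne_zero_of_ne_bot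
      (LinearMap.ker_ne_bot_of_finrank_lt (f := φ) (by simp; lia))
    refine ⟨v, hv0, ?_⟩
    have hs (s : Matrix.SpecialLinearGroup (Fin n) F) (hs : s ∈ List.ofFn f) : s • v = (mu : F) • v := by
      obtain ⟨i, rfl⟩ := (List.mem_ofFn' ..).1 hs
      have hi : ((c i)⁻¹ • v) ⟨n - 1, by lia⟩ = 0 := congrFun (LinearMap.mem_ker.1 hv) i
      have hw : y • (c i)⁻¹ • v = (mu : F) • (c i)⁻¹ • v := by
        generalize (c i)⁻¹ • v = w at hi
        rw [Matrix.SpecialLinearGroup.smul_def, hy]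
        ext j
        rw [Matrix.smul_eq_mulVec, Matrix.mulVec_diagonal]
        split_ifs with hj
        · have hwj : w j = 0 := (congrArg w (Fin.ext hj)).trans hi
          simp [hwj]
        · rfl
      rw [← hc, mul_smul, mul_smul, hw, smul_comm, smul_inv_smul]
    rw [← hfg, list_prod_smul_eq _ hs, List.length_ofFn]
  refine lt_of_lt_of_le ?_ (le_walkL1Dist _ t A hsupp)
  have hG : (0 : ℝ) < Fintype.card (Matrix.SpecialLinearGroup (Fin n) F) := by exact_mod_cast Fintype.card_pos
  have h1 : (Nat.card A : ℝ) / Fintype.card (Matrix.SpecialLinearGroup (Fin n) F) ≤ 1 / 2 := by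
    rw [div_le_div_iff₀ hG two_pos, one_mul]
    exact_mod_cast hcount
  have h2 : 1 / Real.exp 1 < 1 / 2 :=
    one_div_lt_one_div_of_lt two_pos (by linarith [Real.exp_one_gt_d9])
  linarith
end

section
/- For every n ≥ 2 there exists Q(n) such that for every prime power q ≥ Q(n), every non-central element x of G = SL_n(𝔽_q), and every integer t ≥ 2n + 3, one has ‖P^t − U‖₁ < 1/e, where P^t is the t-step distribution of the random walk driven by the conjugacy class C = x^G. In particular the mixing time T(G, x) is at most 2n + 3 for all sufficiently large q. -/
open Matrix in
open scoped ComplexOrder MatrixOrder in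
theorem exists_eq_conjTranspose_mul_self_of_posDef {n : ℕ} {P : Matrix (Fin n) (Fin n) ℂ}
    (h : P.PosDef) : ∃ Q : Matrix (Fin n) (Fin n) ℂ, IsUnit Q ∧ P = Qᴴ * Q := by
  obtain ⟨Q, hQ⟩ := CStarAlgebra.nonneg_iff_eq_star_mul_self.mp h.posSemidef.nonneg
  refine ⟨Q, ?_, hQ⟩
  have hu : IsUnit P := h.isUnit
  rw [hQ, star_eq_conjTranspose] at hu
  rw [Matrix.isUnit_iff_isUnit_det] at hu ⊢
  rw [det_mul] at hu
  exact isUnit_of_mul_isUnit_right hu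

theorem trace_mulLeft_monoidAlgebra {G : Type*} [Group G] [Fintype G] [DecidableEq G] (g : G) :
    LinearMap.trace ℂ (MonoidAlgebra ℂ G) (LinearMap.mulLeft ℂ (MonoidAlgebra.of ℂ G g)) =
      if g = 1 then (Fintype.card G : ℂ) else 0 := by
  rw [LinearMap.trace_eq_matrix_trace ℂ (MonoidAlgebra.basis G ℂ), Matrix.trace]
  have : ∀ h : G, (LinearMap.toMatrix (MonoidAlgebra.basis G ℂ) (MonoidAlgebra.basis G ℂ)
      (LinearMap.mulLeft ℂ (MonoidAlgebra.of ℂ G g))).diag h = if g = 1 then 1 else 0 := by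
    intro h
    rw [Matrix.diag_apply, LinearMap.toMatrix_apply, MonoidAlgebra.basis_apply,
      LinearMap.mulLeft_apply, MonoidAlgebra.of_apply, MonoidAlgebra.single_mul_single,
      mul_one, ← MonoidAlgebra.basis_apply, Module.Basis.repr_self, Finsupp.single_apply]
    simp
  rw [Finset.sum_congr rfl fun h _ => this h]
  simp

theorem trace_mulLeft_pi_matrix {r : ℕ} {d : Fin r → ℕ}
    (a : Π i, Matrix (Fin (d i)) (Fin (d i)) ℂ) :
    LinearMap.trace ℂ (Π i, Matrix (Fin (d i)) (Fin (d i)) ℂ) (LinearMap.mulLeft ℂ a) =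
      ∑ i, (d i : ℂ) * (a i).trace := by
  rw [LinearMap.trace_eq_matrix_trace ℂ
    (Pi.basis fun i => Matrix.stdBasis ℂ (Fin (d i)) (Fin (d i))), Matrix.trace,
    Fintype.sum_sigma]
  refine Finset.sum_congr rfl fun i _ => ?_
  rw [Fintype.sum_prod_type]
  have : ∀ j k, (LinearMap.toMatrix (Pi.basis fun i => Matrix.stdBasis ℂ (Fin (d i)) (Fin (d i)))
      (Pi.basis fun i => Matrix.stdBasis ℂ (Fin (d i)) (Fin (d i)))
      (LinearMap.mulLeft ℂ a)).diag ⟨i, (j, k)⟩ = a i j j := by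
    intro j k
    rw [Matrix.diag_apply, LinearMap.toMatrix_apply, Pi.basis_apply, Matrix.stdBasis_eq_single,
      LinearMap.mulLeft_apply, Pi.basis_repr]
    simp only [Pi.mul_apply, Pi.single_eq_same]
    have hr : ∀ (M : Matrix (Fin (d i)) (Fin (d i)) ℂ) (p : Fin (d i) × Fin (d i)),
        (Matrix.stdBasis ℂ (Fin (d i)) (Fin (d i))).repr M p = M p.1 p.2 := by
      intro M p
      simp [Matrix.stdBasis]
    rw [hr]
    simp
  rw [Finset.sum_congr rfl fun j _ => Finset.sum_congr rfl fun k _ => this j k]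
  simp [Matrix.trace, Finset.mul_sum]

/-- A complete family of irreducible unitary matrix representations of a finite group. -/
structure UnitaryDual (G : Type*) [Group G] [Fintype G] where
  /-- the number of representations -/
  r : ℕ
  /-- the degrees -/
  d : Fin r → ℕ
  d_pos : ∀ i, 0 < d i
  /-- the representations -/
  ρ : ∀ i, G →* Matrix (Fin (d i)) (Fin (d i)) ℂ
  unitary : ∀ i g, (ρ i g).conjTranspose * ρ i g = 1
  schur : ∀ i A, (∀ g, A * ρ i g = ρ i g * A) → ∃ c : ℂ, A = c • (1 : Matrix _ _ ℂ)
  plancherel : ∀ g, g ≠ 1 → ∑ i, (d i : ℂ) * (ρ i g).trace = 0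
  sum_sq : ∑ i, (d i : ℂ) * d i = Fintype.card G

open Matrix in
open scoped ComplexOrder in
theorem exists_unitary_conj {G : Type*} [Group G] [Fintype G] {n : ℕ}
    (ρ : G →* Matrix (Fin n) (Fin n) ℂ) :
    ∃ Q R : Matrix (Fin n) (Fin n) ℂ, R * Q = 1 ∧ Q * R = 1 ∧
      ∀ g, (Q * ρ g * R)ᴴ * (Q * ρ g * R) = 1 := by
  classical
  have hP : (∑ g, (ρ g)ᴴ * ρ g).PosDef := by
    rw [← Finset.add_sum_erase _ _ (Finset.mem_univ 1)]
    refine PosDef.add_posSemidef ?_ (posSemidef_sum _ fun g _ =>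
      posSemidef_conjTranspose_mul_self _)
    simpa using PosDef.one
  obtain ⟨Q, hQ, hPQ⟩ := exists_eq_conjTranspose_mul_self_of_posDef hP
  have hd := (Matrix.isUnit_iff_isUnit_det _).mp hQ
  refine ⟨Q, Q⁻¹, Matrix.nonsing_inv_mul _ hd, Matrix.mul_nonsing_inv _ hd, fun g => ?_⟩
  have hinv : (ρ g)ᴴ * (Qᴴ * Q) * ρ g = Qᴴ * Q := by
    rw [← hPQ, Finset.mul_sum, Finset.sum_mul]
    refine Fintype.sum_equiv (Equiv.mulRight g) _ _ fun h => ?_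
    simp [Matrix.mul_assoc]
  have h1 : Q * Q⁻¹ = 1 := Matrix.mul_nonsing_inv _ hd
  have h2 : Q⁻¹ᴴ * Qᴴ = 1 := by rw [← conjTranspose_mul, h1, conjTranspose_one]
  calc (Q * ρ g * Q⁻¹)ᴴ * (Q * ρ g * Q⁻¹) = Q⁻¹ᴴ * ((ρ g)ᴴ * (Qᴴ * Q) * ρ g) * Q⁻¹ := by
        simp only [conjTranspose_mul, Matrix.mul_assoc]
    _ = (Q⁻¹ᴴ * Qᴴ) * (Q * Q⁻¹) := by rw [hinv]; simp only [Matrix.mul_assoc]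
    _ = 1 := by rw [h1, h2, one_mul]

theorem exists_irreducible_family (G : Type*) [Group G] [Fintype G] :
    ∃ (r : ℕ) (d : Fin r → ℕ) (_ : ∀ i, 0 < d i)
      (ρ : ∀ i, G →* Matrix (Fin (d i)) (Fin (d i)) ℂ),
      (∀ i A, (∀ g, A * ρ i g = ρ i g * A) → ∃ c : ℂ, A = c • (1 : Matrix _ _ ℂ)) ∧
      (∀ g, g ≠ 1 → ∑ i, (d i : ℂ) * (ρ i g).trace = 0) ∧
      ∑ i, (d i : ℂ) * d i = Fintype.card G := by
  classical
  have : NeZero (Nat.card G : ℂ) := ⟨by simp⟩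
  have : Module.Finite ℂ (MonoidAlgebra ℂ G) := Module.Finite.of_basis (MonoidAlgebra.basis G ℂ)
  obtain ⟨r, d, hd, ⟨e⟩⟩ := IsSemisimpleRing.exists_algEquiv_pi_matrix_of_isAlgClosed ℂ
    (MonoidAlgebra ℂ G)
  have htr : ∀ g, ∑ i, (d i : ℂ) * (e (MonoidAlgebra.of ℂ G g) i).trace =
      if g = 1 then (Fintype.card G : ℂ) else 0 := by
    intro g
    rw [← trace_mulLeft_pi_matrix, ← trace_mulLeft_monoidAlgebra,
      ← LinearMap.trace_conj' _ e.toLinearEquiv]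
    congr 1
    refine LinearMap.ext fun y => ?_
    simp [LinearEquiv.conj_apply]
  refine ⟨r, d, fun i => Nat.pos_of_ne_zero (hd i).out, fun i =>
    { toFun := fun g => e (MonoidAlgebra.of ℂ G g) i
      map_one' := by rw [map_one, map_one]; rfl
      map_mul' := fun g h => by rw [map_mul, map_mul]; rfl }, ?_, ?_, ?_⟩
  · intro i A hA
    have hall : ∀ y : MonoidAlgebra ℂ G, A * e y i = e y i * A := by
      intro y
      induction y using MonoidAlgebra.induction_on with
      | of g => exact hA g
      | add x y hx hy => rw [map_add, Pi.add_apply, mul_add, add_mul, hx, hy]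
      | smul c x hx => rw [map_smul, Pi.smul_apply, mul_smul_comm, smul_mul_assoc, hx]
    have hcomm : ∀ B : Matrix (Fin (d i)) (Fin (d i)) ℂ, Commute B A := by
      intro B
      have := hall (e.symm (Pi.single i B))
      rw [e.apply_symm_apply, Pi.single_eq_same] at this
      exact this.symm
    obtain ⟨c, hc⟩ := (Matrix.mem_range_scalar_iff_commute_single').mpr
      (fun a b => hcomm (Matrix.single a b 1))
    exact ⟨c, by rw [← hc, Matrix.scalar_apply, Matrix.smul_one_eq_diagonal]⟩
  · intro g hg
    simpa [hg] using htr g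
  · have := htr 1
    rw [map_one, map_one] at this
    simpa using this

open Matrix in
theorem nonempty_unitaryDual (G : Type*) [Group G] [Fintype G] : Nonempty (UnitaryDual G) := by
  obtain ⟨r, d, hd, ρ, hs, hp, hsq⟩ := exists_irreducible_family G
  choose Q R hRQ hQR hu using fun i => exists_unitary_conj (ρ i)
  have hcancel : ∀ i A B, Q i * A * R i * (Q i * B * R i) = Q i * (A * B) * R i := by
    intro i A B
    calc Q i * A * R i * (Q i * B * R i) = Q i * A * (R i * Q i) * B * R i := by
          simp only [Matrix.mul_assoc]
      _ = _ := by rw [hRQ, mul_one, Matrix.mul_assoc (Q i)]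
  refine ⟨⟨r, d, hd, fun i =>
    { toFun := fun g => Q i * ρ i g * R i
      map_one' := by rw [map_one, mul_one, hQR]
      map_mul' := fun g h => by rw [hcancel, map_mul] }, hu, ?_, ?_, hsq⟩⟩
  · intro i A hA
    obtain ⟨c, hc⟩ := hs i (R i * A * Q i) (fun g => by
      have := congrArg (fun M => R i * M * Q i) (hA g)
      simp only [MonoidHom.coe_mk, OneHom.coe_mk] at this
      calc R i * A * Q i * ρ i g = R i * A * Q i * ρ i g * (R i * Q i) := by rw [hRQ, mul_one]
        _ = R i * (A * (Q i * ρ i g * R i)) * Q i := by simp only [Matrix.mul_assoc]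
        _ = R i * (Q i * ρ i g * R i * A) * Q i := this
        _ = R i * Q i * ρ i g * (R i * A * Q i) := by simp only [Matrix.mul_assoc]
        _ = _ := by rw [hRQ, one_mul])
    refine ⟨c, ?_⟩
    calc A = (Q i * R i) * A * (Q i * R i) := by rw [hQR, one_mul, mul_one]
      _ = Q i * (R i * A * Q i) * R i := by simp only [Matrix.mul_assoc]
      _ = c • 1 := by rw [hc, mul_smul_comm, mul_one, smul_mul_assoc, hQR]
  · intro g hg
    rw [← hp g hg]
    refine Finset.sum_congr rfl fun i _ => ?_
    congr 1
    change (Q i * ρ i g * R i).trace = _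
    rw [Matrix.trace_mul_comm, ← Matrix.mul_assoc, hRQ, one_mul]

namespace UnitaryDual

open Matrix

variable {G : Type*} [Group G] [Fintype G] (D : UnitaryDual G)

/-- The normalized character values. -/
noncomputable def w (i : Fin D.r) (g : G) : ℂ := (D.ρ i g).trace / D.d i

/-- The indices of the nontrivial representations. -/
noncomputable def nontriv : Finset (Fin D.r) := by
  classical exact Finset.univ.filter fun i => ∃ g, D.ρ i g ≠ 1

theorem mem_nontriv {i : Fin D.r} : i ∈ D.nontriv ↔ ∃ g, D.ρ i g ≠ 1 := by
  simp [nontriv]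

theorem d_ne_zero (i : Fin D.r) : (D.d i : ℂ) ≠ 0 := by
  exact_mod_cast (D.d_pos i).ne'

theorem d_mul_w (i : Fin D.r) (g : G) : (D.d i : ℂ) * D.w i g = (D.ρ i g).trace := by
  rw [w, mul_div_cancel₀ _ (D.d_ne_zero i)]

theorem ρ_inv (i : Fin D.r) (g : G) : D.ρ i g⁻¹ = (D.ρ i g)ᴴ := by
  calc D.ρ i g⁻¹ = ((D.ρ i g)ᴴ * D.ρ i g) * D.ρ i g⁻¹ := by rw [D.unitary, one_mul]
    _ = (D.ρ i g)ᴴ := by rw [mul_assoc, ← map_mul]; simp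

theorem w_inv (i : Fin D.r) (g : G) : D.w i g⁻¹ = star (D.w i g) := by
  rw [w, w, ρ_inv, trace_conjTranspose]
  simp

theorem w_conj (i : Fin D.r) (c g : G) : D.w i (c * g * c⁻¹) = D.w i g := by
  rw [w, w, map_mul, trace_mul_comm, ← map_mul]
  simp

theorem w_one (i : Fin D.r) : D.w i 1 = 1 := by
  simp [w, D.d_ne_zero i]

/-- A conjugation invariant sum acts as a scalar. -/
theorem sum_ρ_eq_smul {J : Type*} [Fintype J] (a : J → G)
    (ha : ∀ g, ∃ σ : J ≃ J, ∀ j, a (σ j) = g * a j * g⁻¹) (i : Fin D.r) :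
    ∑ j, D.ρ i (a j) = (∑ j, D.w i (a j)) • (1 : Matrix _ _ ℂ) := by
  obtain ⟨c, hc⟩ := D.schur i (∑ j, D.ρ i (a j)) (fun g => by
    obtain ⟨σ, hσ⟩ := ha g
    calc (∑ j, D.ρ i (a j)) * D.ρ i g = (∑ j, D.ρ i (a (σ j))) * D.ρ i g := by
          rw [Equiv.sum_comp σ (fun j => D.ρ i (a j))]
      _ = D.ρ i g * ∑ j, D.ρ i (a j) := by
          rw [Finset.sum_mul, Finset.mul_sum]
          refine Finset.sum_congr rfl fun j _ => ?_
          rw [← map_mul, ← map_mul, hσ]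
          simp)
  have ht := congrArg Matrix.trace hc
  rw [trace_sum, trace_smul, trace_one, Fintype.card_fin, smul_eq_mul] at ht
  rw [hc]
  congr 1
  have hd := D.d_ne_zero i
  rw [← mul_left_inj' hd, ← ht, Finset.sum_mul]
  exact Finset.sum_congr rfl fun j _ => by rw [mul_comm, d_mul_w]

/-- The squared Hilbert-Schmidt norm. -/
noncomputable def _root_.Matrix.hsq {d : ℕ} (A : Matrix (Fin d) (Fin d) ℂ) : ℝ :=
  ∑ p : Fin d × Fin d, ‖A p.1 p.2‖ ^ 2

theorem _root_.Matrix.trace_conjTranspose_mul_eq_sum {d : ℕ} (A B : Matrix (Fin d) (Fin d) ℂ) :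
    (Aᴴ * B).trace = ∑ p : Fin d × Fin d, star (A p.1 p.2) * B p.1 p.2 := by
  rw [Fintype.sum_prod_type, Finset.sum_comm]
  simp [Matrix.trace, Matrix.mul_apply]

theorem _root_.Matrix.trace_conjTranspose_mul_self_eq_hsq {d : ℕ} (A : Matrix (Fin d) (Fin d) ℂ) :
    (Aᴴ * A).trace = A.hsq := by
  rw [trace_conjTranspose_mul_eq_sum, hsq]
  push_cast
  refine Finset.sum_congr rfl fun p _ => ?_
  exact Complex.conj_mul' _

theorem _root_.Matrix.hsq_nonneg {d : ℕ} (A : Matrix (Fin d) (Fin d) ℂ) : 0 ≤ A.hsq :=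
  Finset.sum_nonneg fun _ _ => by positivity

theorem _root_.Matrix.norm_trace_sq_le {d : ℕ} (A B : Matrix (Fin d) (Fin d) ℂ) :
    ‖(Aᴴ * B).trace‖ ^ 2 ≤ A.hsq * B.hsq := by
  rw [trace_conjTranspose_mul_eq_sum]
  calc _ ≤ (∑ p : Fin d × Fin d, ‖A p.1 p.2‖ * ‖B p.1 p.2‖) ^ 2 := by
        gcongr
        refine (norm_sum_le _ _).trans_eq ?_
        simp
    _ ≤ _ := Finset.sum_mul_sq_le_sq_mul_sq _ _ _

theorem hsq_ρ (i : Fin D.r) (g : G) : (D.ρ i g).hsq = D.d i := by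
  have := trace_conjTranspose_mul_self_eq_hsq (D.ρ i g)
  rw [D.unitary, trace_one, Fintype.card_fin] at this
  exact_mod_cast this.symm

theorem norm_w_le_one (i : Fin D.r) (g : G) : ‖D.w i g‖ ≤ 1 := by
  have h := norm_trace_sq_le 1 (D.ρ i g)
  have h1 := D.hsq_ρ i 1
  rw [map_one] at h1
  rw [hsq_ρ, h1, conjTranspose_one, one_mul, ← sq] at h
  have h2 := abs_le_of_sq_le_sq' h (by positivity)
  rw [w, norm_div, Complex.norm_natCast]
  exact div_le_one_of_le₀ h2.2 (by positivity)

theorem isIdempotent_avg {M : Type*} [AddCommGroup M] [Fintype M] (k : M → G)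
    (hk : ∀ a b, k (a + b) = k a * k b) (i : Fin D.r) :
    ((Fintype.card M : ℂ)⁻¹ • ∑ m, D.ρ i (k m)) * ((Fintype.card M : ℂ)⁻¹ • ∑ m, D.ρ i (k m)) =
      (Fintype.card M : ℂ)⁻¹ • ∑ m, D.ρ i (k m) := by
  have hM : (Fintype.card M : ℂ) ≠ 0 := by simp
  have h1 : ∀ a, D.ρ i (k a) * ∑ m, D.ρ i (k m) = ∑ m, D.ρ i (k m) := by
    intro a
    rw [Finset.mul_sum]
    refine Fintype.sum_equiv (Equiv.addLeft a) _ _ fun m => ?_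
    rw [← map_mul, ← hk]
    rfl
  rw [smul_mul_smul_comm, Finset.sum_mul, Finset.sum_congr rfl fun a _ => h1 a]
  simp only [Finset.sum_const, Finset.card_univ]
  rw [← Nat.cast_smul_eq_nsmul ℂ, smul_smul, mul_assoc, inv_mul_cancel₀ hM, mul_one]

/-- If `k` is a homomorphism all whose values are commutators with `x`, then the character ratio
of `x` is bounded by the average character ratio along `k`. -/
theorem norm_w_le_avg {M : Type*} [AddCommGroup M] [Fintype M] (k h : M → G) (x : G)
    (hk : ∀ a b, k (a + b) = k a * k b) (hc : ∀ a, k a = h a * x * (h a)⁻¹ * x⁻¹)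
    (i : Fin D.r) :
    ‖D.w i x‖ ≤ (Fintype.card M : ℝ)⁻¹ * ∑ m, ‖D.w i (k m)‖ := by
  have hM : (Fintype.card M : ℂ) ≠ 0 := by simp
  set π : Matrix _ _ ℂ := (Fintype.card M : ℂ)⁻¹ • ∑ m, D.ρ i (k m) with hπ
  have hidem : π * π = π := D.isIdempotent_avg k hk i
  have h0 : k 0 = 1 := by simpa using hk 0 0
  have hneg : ∀ m, k (-m) = (k m)⁻¹ := fun m => by
    rw [eq_inv_iff_mul_eq_one, ← hk, neg_add_cancel, h0]
  have hherm : πᴴ = π := by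
    rw [hπ, conjTranspose_smul, conjTranspose_sum]
    congr 1
    · simp
    · refine Fintype.sum_equiv (Equiv.neg M) _ _ fun m => ?_
      rw [← ρ_inv, Equiv.neg_apply, hneg]
  have hX : D.ρ i x * (D.ρ i x)ᴴ = 1 := by rw [← ρ_inv, ← map_mul]; simp
  have htr : (π * D.ρ i x).trace = (D.ρ i x).trace := by
    have h1 : ∀ m, (D.ρ i (k m) * D.ρ i x).trace = (D.ρ i x).trace := by
      intro m
      rw [← map_mul, hc, ← d_mul_w, ← d_mul_w, inv_mul_cancel_right, w_conj]
    rw [hπ, smul_mul_assoc, Finset.sum_mul, trace_smul, trace_sum,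
      Finset.sum_congr rfl fun m _ => h1 m]
    simp only [Finset.sum_const, Finset.card_univ, nsmul_eq_mul, smul_eq_mul]
    rw [inv_mul_cancel_left₀ hM]
  have hs1 : (π.hsq : ℂ) = π.trace := by
    rw [← trace_conjTranspose_mul_self_eq_hsq, hherm, hidem]
  have hs2 : ((π * D.ρ i x).hsq : ℂ) = π.trace := by
    rw [← trace_conjTranspose_mul_self_eq_hsq, trace_mul_comm, conjTranspose_mul, Matrix.mul_assoc,
      ← Matrix.mul_assoc (D.ρ i x), hX, one_mul, hherm, hidem]
  have hs3 : (π * D.ρ i x).hsq = π.hsq := by exact_mod_cast hs2.trans hs1.symm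
  have hcs := norm_trace_sq_le π (π * D.ρ i x)
  rw [hs3, ← sq, ← Matrix.mul_assoc, hherm, hidem, htr] at hcs
  have h2 := (abs_le_of_sq_le_sq' hcs π.hsq_nonneg).2
  have h3 : π.hsq ≤ (Fintype.card M : ℝ)⁻¹ * ∑ m, D.d i * ‖D.w i (k m)‖ := by
    have : π.hsq = ‖(π.hsq : ℂ)‖ := by
      rw [Complex.norm_real, Real.norm_of_nonneg π.hsq_nonneg]
    rw [this, hs1, hπ, trace_smul, trace_sum, norm_smul, norm_inv, Complex.norm_natCast]
    gcongr
    refine (norm_sum_le _ _).trans_eq (Finset.sum_congr rfl fun m _ => ?_)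
    rw [← d_mul_w, norm_mul, Complex.norm_natCast]
  have hd : (0 : ℝ) < D.d i := by exact_mod_cast D.d_pos i
  rw [← d_mul_w, norm_mul, Complex.norm_natCast] at h2
  rw [← Finset.mul_sum, mul_left_comm] at h3
  exact le_of_mul_le_mul_left (h2.trans h3) hd

end UnitaryDual

theorem sum_pow_eq_sum_ofFn_prod {R J : Type*} [Semiring R] [Fintype J] (a : J → R) (t : ℕ) :
    (∑ j, a j) ^ t = ∑ f : Fin t → J, (List.ofFn fun s => a (f s)).prod := by
  induction t with
  | zero => simp
  | succ t ih =>
    rw [pow_succ', ih, Finset.sum_mul_sum, ← Fintype.sum_prod_type']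
    refine Fintype.sum_equiv (Fin.consEquiv fun _ => J) _ _ fun p => ?_
    simp [List.ofFn_succ, Fin.consEquiv]

namespace UnitaryDual

open Matrix

variable {G : Type*} [Group G] [Fintype G] (D : UnitaryDual G)

theorem plancherel_ite [DecidableEq G] (g : G) :
    ∑ i, (D.d i : ℂ) * (D.ρ i g).trace = if g = 1 then (Fintype.card G : ℂ) else 0 := by
  split_ifs with h
  · rw [h, ← D.sum_sq]
    simp
  · exact D.plancherel g h

theorem sum_ρ_ofFn_prod {J : Type*} [Fintype J] (a : J → G) (t : ℕ) (i : Fin D.r) :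
    (∑ j, D.ρ i (a j)) ^ t = ∑ f : Fin t → J, D.ρ i (List.ofFn fun s => a (f s)).prod := by
  rw [sum_pow_eq_sum_ofFn_prod]
  refine Finset.sum_congr rfl fun f _ => ?_
  rw [map_list_prod, List.map_ofFn]
  rfl

/-- Character formula for the number of factorizations of the identity. -/
theorem sum_sq_mul_pow_eq_card {J : Type*} [Fintype J] (a : J → G)
    (ha : ∀ g, ∃ σ : J ≃ J, ∀ j, a (σ j) = g * a j * g⁻¹) (t : ℕ) :
    ∑ i, (D.d i : ℂ) ^ 2 * (∑ j, D.w i (a j)) ^ t =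
      Fintype.card G * Nat.card {f : Fin t → J // (List.ofFn fun s => a (f s)).prod = 1} := by
  classical
  have h1 : ∀ i, (D.d i : ℂ) ^ 2 * (∑ j, D.w i (a j)) ^ t =
      ∑ f : Fin t → J, (D.d i : ℂ) * (D.ρ i (List.ofFn fun s => a (f s)).prod).trace := by
    intro i
    rw [← Finset.mul_sum, ← trace_sum, ← sum_ρ_ofFn_prod, D.sum_ρ_eq_smul a ha, smul_pow, one_pow,
      trace_smul, trace_one, Fintype.card_fin, smul_eq_mul]
    ring
  rw [Finset.sum_congr rfl fun i _ => h1 i, Finset.sum_comm,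
    Finset.sum_congr rfl fun f _ => D.plancherel_ite _, Finset.sum_ite, Finset.sum_const_zero,
    add_zero, Finset.sum_const, nsmul_eq_mul, mul_comm, Nat.card_eq_fintype_card,
    Fintype.card_subtype]

/-- Column orthogonality. -/
theorem sum_sq_mul_norm_sq_eq_card (x : G) :
    ∑ i, (D.d i : ℝ) ^ 2 * ‖D.w i x‖ ^ 2 = Nat.card {c : G // c * x = x * c} := by
  classical
  have hG : (Fintype.card G : ℂ) ≠ 0 := by simp
  have h1 : ∀ i, (Fintype.card G : ℂ) * ((D.d i : ℂ) ^ 2 * ‖D.w i x‖ ^ 2) =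
      ∑ c : G, (D.d i : ℂ) * (D.ρ i (c * x * c⁻¹ * x⁻¹)).trace := by
    intro i
    have h2 := D.sum_ρ_eq_smul (fun c : G => c * x * c⁻¹)
      (fun g => ⟨Equiv.mulLeft g, fun j => by simp [mul_assoc]⟩) i
    simp only [w_conj] at h2
    simp_rw [map_mul _ _ x⁻¹]
    rw [← Finset.mul_sum, ← trace_sum, ← Finset.sum_mul, h2, smul_mul_assoc, one_mul, trace_smul,
      ← d_mul_w, w_inv, Finset.sum_const, Finset.card_univ, nsmul_eq_mul, smul_eq_mul,
      ← Complex.mul_conj']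
    simp only [RCLike.star_def]
    ring
  have h3 : (Fintype.card G : ℂ) * ∑ i, (D.d i : ℂ) ^ 2 * ‖D.w i x‖ ^ 2 =
      Fintype.card G * Nat.card {c : G // c * x = x * c} := by
    rw [Finset.mul_sum, Finset.sum_congr rfl fun i _ => h1 i, Finset.sum_comm,
      Finset.sum_congr rfl fun f _ => D.plancherel_ite _, Finset.sum_ite, Finset.sum_const_zero,
      add_zero, Finset.sum_const, nsmul_eq_mul, mul_comm, Nat.card_eq_fintype_card,
      Fintype.card_subtype]
    congr 3
    ext c
    simp only [Finset.mem_filter, Finset.mem_univ, true_and]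
    rw [mul_inv_eq_one, mul_inv_eq_iff_eq_mul]
  have h4 := mul_left_cancel₀ hG h3
  exact_mod_cast h4

theorem sum_sq_real : ∑ i, (D.d i : ℝ) ^ 2 = Fintype.card G := by
  have := D.sum_sq
  simp_rw [← sq] at this
  exact_mod_cast this

/-- Plancherel's formula. -/
theorem sum_hsq (f : G → ℝ) :
    ∑ i, (D.d i : ℝ) * (∑ g, (f g : ℂ) • D.ρ i g).hsq = Fintype.card G * ∑ g, f g ^ 2 := by
  classical
  have h1 : ∀ i, (D.d i : ℂ) * ((∑ g, (f g : ℂ) • D.ρ i g).hsq : ℂ) =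
      ∑ g, ∑ h, (f g * f h : ℂ) * ((D.d i : ℂ) * (D.ρ i (g⁻¹ * h)).trace) := by
    intro i
    rw [← trace_conjTranspose_mul_self_eq_hsq, conjTranspose_sum, Finset.sum_mul, trace_sum,
      Finset.mul_sum]
    refine Finset.sum_congr rfl fun g _ => ?_
    rw [Finset.mul_sum, trace_sum, Finset.mul_sum]
    refine Finset.sum_congr rfl fun h _ => ?_
    rw [conjTranspose_smul, ← ρ_inv, smul_mul_smul_comm, ← map_mul, trace_smul, smul_eq_mul]
    simp only [RCLike.star_def, Complex.conj_ofReal]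
    ring
  have h2 : ∑ i, (D.d i : ℂ) * ((∑ g, (f g : ℂ) • D.ρ i g).hsq : ℂ) =
      Fintype.card G * ∑ g, (f g : ℂ) ^ 2 := by
    rw [Finset.sum_congr rfl fun i _ => h1 i, Finset.sum_comm, Finset.mul_sum]
    refine Finset.sum_congr rfl fun g _ => ?_
    rw [Finset.sum_comm]
    simp_rw [← Finset.mul_sum, plancherel_ite, inv_mul_eq_one]
    simp
    ring
  exact_mod_cast h2

theorem sum_ρ_eq_zero {i : Fin D.r} (hi : i ∈ D.nontriv) : ∑ g, D.ρ i g = 0 := by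
  obtain ⟨g, hg⟩ := D.mem_nontriv.mp hi
  have h1 := D.sum_ρ_eq_smul (fun g : G => g)
      (fun g => ⟨(MulAut.conj g).toEquiv, fun j => by simp⟩) i
  have h2 : D.ρ i g * ∑ h, D.ρ i h = ∑ h, D.ρ i h := by
    rw [Finset.mul_sum]
    exact Fintype.sum_equiv (Equiv.mulLeft g) _ _ fun m => by simp
  rw [h1] at h2 ⊢
  by_cases hc : ∑ j, D.w i j = 0
  · rw [hc, zero_smul]
  · rw [mul_smul_comm, mul_one] at h2
    exact absurd (smul_right_injective _ hc h2) hg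

/-- The upper bound lemma for walks driven by a conjugacy class. -/
theorem walkL1Dist_sq_le (x : G) (t : ℕ) :
    walkL1Dist {z : G | ∃ c, c * x * c⁻¹ = z} t ^ 2 ≤
      ∑ i ∈ D.nontriv, (D.d i : ℝ) ^ 2 * (‖D.w i x‖ ^ t) ^ 2 := by
  classical
  set S : Set G := {z : G | ∃ c, c * x * c⁻¹ = z} with hS
  set f : G → ℝ := fun g => walkProb S t g - 1 / (Fintype.card G : ℝ) with hf
  have hSx : x ∈ S := ⟨1, by simp⟩
  have : Nonempty S := ⟨⟨x, hSx⟩⟩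
  have hSc : (Fintype.card S : ℂ) ≠ 0 := by simp
  have hSw : ∀ i (s : S), D.w i s = D.w i x := by
    rintro i ⟨_, c, rfl⟩
    exact D.w_conj i c x
  have hcount : ∀ i, (∑ g, (walkProb S t g : ℂ) • D.ρ i g) =
      ((Fintype.card S : ℂ) ^ t)⁻¹ • (∑ s : S, D.ρ i s) ^ t := by
    intro i
    rw [sum_ρ_ofFn_prod, ← Finset.sum_fiberwise Finset.univ
      (fun f : Fin t → S => (List.ofFn fun s => (f s : G)).prod), Finset.smul_sum]
    refine Finset.sum_congr rfl fun g _ => ?_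
    rw [Finset.sum_congr rfl (g := fun _ => D.ρ i g)
      (fun f hf => by rw [(Finset.mem_filter.mp hf).2]), Finset.sum_const,
      ← Nat.cast_smul_eq_nsmul ℂ, smul_smul, walkProb]
    congr 1
    push_cast
    rw [div_eq_mul_inv, mul_comm, Nat.card_eq_fintype_card]
    congr 2
    rw [← Fintype.card_subtype, ← Nat.card_eq_fintype_card]
    exact Nat.card_congr
      { toFun := fun f => ⟨fun s => ⟨f.1 s, f.2.1 s⟩, f.2.2⟩
        invFun := fun f => ⟨fun s => f.1 s, fun s => (f.1 s).2, f.2⟩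
        left_inv := fun _ => rfl
        right_inv := fun _ => rfl }
  have hsum : ∀ i, ∑ s : S, D.ρ i s = (Fintype.card S * D.w i x) • (1 : Matrix _ _ ℂ) := by
    intro i
    rw [D.sum_ρ_eq_smul (fun s : S => (s : G)) (fun g => ?_), Finset.sum_congr rfl
      fun s _ => hSw i s]
    · simp
    · refine ⟨(MulAut.conj g).toEquiv.subtypeEquiv fun a => ?_, fun j => rfl⟩
      constructor
      · rintro ⟨c, rfl⟩
        exact ⟨g * c, by simp [mul_assoc]⟩
      · rintro ⟨c, hc⟩
        refine ⟨g⁻¹ * c, ?_⟩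
        simp only [MulEquiv.toEquiv_eq_coe, MulEquiv.coe_toEquiv, MulAut.conj_apply] at hc
        rw [_root_.mul_inv_rev, inv_inv, ← mul_assoc, mul_assoc g⁻¹, mul_assoc g⁻¹, hc]
        group
  have hwalk : ∀ i, (∑ g, (walkProb S t g : ℂ) • D.ρ i g) = D.w i x ^ t • (1 : Matrix _ _ ℂ) := by
    intro i
    rw [hcount, hsum, smul_pow, one_pow, smul_smul, mul_pow,
      inv_mul_cancel_left₀ (pow_ne_zero _ hSc)]
  have hone : ∀ i, (1 : Matrix (Fin (D.d i)) (Fin (D.d i)) ℂ).hsq = D.d i := by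
    intro i
    rw [← map_one (D.ρ i), hsq_ρ]
  have hf1 : ∀ i, ∑ g, (f g : ℂ) • D.ρ i g =
      D.w i x ^ t • (1 : Matrix _ _ ℂ) - (Fintype.card G : ℂ)⁻¹ • ∑ g, D.ρ i g := by
    intro i
    rw [← hwalk, Finset.smul_sum, ← Finset.sum_sub_distrib]
    refine Finset.sum_congr rfl fun g _ => ?_
    rw [hf, ← sub_smul]
    simp
  have hterm : ∀ i, (D.d i : ℝ) * (∑ g, (f g : ℂ) • D.ρ i g).hsq =
      if i ∈ D.nontriv then (D.d i : ℝ) ^ 2 * (‖D.w i x‖ ^ t) ^ 2 else 0 := by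
    intro i
    split_ifs with hi
    · rw [hf1, D.sum_ρ_eq_zero hi, smul_zero, sub_zero]
      have : (D.w i x ^ t • (1 : Matrix (Fin (D.d i)) (Fin (D.d i)) ℂ)).hsq =
          (‖D.w i x‖ ^ t) ^ 2 * (1 : Matrix (Fin (D.d i)) (Fin (D.d i)) ℂ).hsq := by
        rw [hsq, hsq, Finset.mul_sum]
        refine Finset.sum_congr rfl fun p _ => ?_
        rw [Matrix.smul_apply, norm_smul, norm_pow, mul_pow]
      rw [this, hone]
      ring
    · have h1 : ∀ g, D.ρ i g = 1 := by
        intro g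
        by_contra hg
        exact hi (D.mem_nontriv.mpr ⟨g, hg⟩)
      have hw : D.w i x = 1 := by
        rw [w, h1, trace_one, Fintype.card_fin, div_self (D.d_ne_zero i)]
      have : ∑ g, (f g : ℂ) • D.ρ i g = 0 := by
        rw [hf1, hw, Finset.sum_congr rfl fun g _ => h1 g, Finset.sum_const, one_pow, one_smul,
          Finset.card_univ, ← Nat.cast_smul_eq_nsmul ℂ, smul_smul, inv_mul_cancel₀ (by simp),
          one_smul, sub_self]
      rw [this]
      simp [hsq]
  calc walkL1Dist S t ^ 2 = (∑ g : G, |f g|) ^ 2 := rfl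
    _ ≤ Fintype.card G * ∑ g : G, |f g| ^ 2 := sq_sum_le_card_mul_sum_sq
    _ = Fintype.card G * ∑ g : G, f g ^ 2 := by simp_rw [sq_abs]
    _ = _ := by
      rw [← D.sum_hsq, Finset.sum_congr rfl fun i _ => hterm i, ← Finset.sum_filter]
      congr 1
      ext i
      simp

end UnitaryDual

namespace Matrix.SpecialLinearGroup

variable {n : ℕ} {F : Type*} [Field F]

/-- The transvection `1 + b φ` attached to a column `b` and a row `φ` with `φ b = 0`
(the identity if `φ b ≠ 0`). -/
noncomputable def tv (b φ : Fin n → F) : SpecialLinearGroup (Fin n) F := by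
  classical exact if h : φ ⬝ᵥ b = 0 then (⟨1 + vecMulVec b φ, by
    rw [vecMulVec_eq Unit, det_one_add_replicateCol_mul_replicateRow, h, add_zero]⟩ :
      SpecialLinearGroup (Fin n) F) else 1

theorem coe_tv {b φ : Fin n → F} (h : φ ⬝ᵥ b = 0) :
    (tv b φ : Matrix (Fin n) (Fin n) F) = 1 + vecMulVec b φ := by
  simp [tv, h]

theorem tv_of_ne {b φ : Fin n → F} (h : φ ⬝ᵥ b ≠ 0) : tv b φ = 1 := by
  simp [tv, h]

theorem tv_zero (φ : Fin n → F) : tv 0 φ = 1 := by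
  ext1
  rw [coe_tv (by simp)]
  simp

theorem tv_add {a b φ : Fin n → F} (ha : φ ⬝ᵥ a = 0) (hb : φ ⬝ᵥ b = 0) :
    tv (a + b) φ = tv a φ * tv b φ := by
  ext1
  rw [coe_mul, coe_tv ha, coe_tv hb, coe_tv (by rw [dotProduct_add, ha, hb, add_zero]),
    add_vecMulVec, mul_add, add_mul, add_mul, vecMulVec_mul_vecMulVec, hb]
  simp [add_assoc]

theorem tv_neg {b φ : Fin n → F} (hb : φ ⬝ᵥ b = 0) : tv (-b) φ = (tv b φ)⁻¹ := by
  rw [eq_inv_iff_mul_eq_one, ← tv_add (by simp [hb]) hb, neg_add_cancel, tv_zero]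

theorem conj_tv (g : SpecialLinearGroup (Fin n) F) (b φ : Fin n → F) :
    g * tv b φ * g⁻¹ = tv (g.1 *ᵥ b) (φ ᵥ* (g⁻¹).1) := by
  have hg : (g⁻¹).1 * g.1 = 1 := by rw [← coe_mul, inv_mul_cancel, coe_one]
  have hg' : g.1 * (g⁻¹).1 = 1 := by rw [← coe_mul, mul_inv_cancel, coe_one]
  have hd : (φ ᵥ* (g⁻¹).1) ⬝ᵥ (g.1 *ᵥ b) = φ ⬝ᵥ b := by
    rw [dotProduct_mulVec, vecMul_vecMul, hg, vecMul_one]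
  by_cases h : φ ⬝ᵥ b = 0
  · ext1
    rw [coe_mul, coe_mul, coe_tv h, coe_tv (hd.trans h), mul_add, add_mul, mul_one, hg',
      mul_vecMulVec, vecMulVec_mul]
  · rw [tv_of_ne h, tv_of_ne (by rwa [hd]), mul_one, mul_inv_cancel]

theorem transpose_tv (b φ : Fin n → F) : (tv b φ).transpose = tv φ b := by
  by_cases h : φ ⬝ᵥ b = 0
  · ext1
    rw [coe_transpose, coe_tv h, coe_tv (by rwa [dotProduct_comm]), transpose_add,
      transpose_one, transpose_vecMulVec]
  · rw [tv_of_ne h, tv_of_ne (by rwa [dotProduct_comm])]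
    exact Subtype.ext (by simp)

theorem tv_mulVec {b φ : Fin n → F} (h : φ ⬝ᵥ b = 0) (v : Fin n → F) :
    (tv b φ).1 *ᵥ v = v + (φ ⬝ᵥ v) • b := by
  rw [coe_tv h, add_mulVec, one_mulVec, vecMulVec_mulVec]
  simp

theorem vecMul_tv {b φ : Fin n → F} (h : φ ⬝ᵥ b = 0) (v : Fin n → F) :
    v ᵥ* (tv b φ).1 = v + (v ⬝ᵥ b) • φ := by
  rw [coe_tv h, vecMul_add, vecMul_one, vecMul_vecMulVec]

theorem isConj_transpose {x y : SpecialLinearGroup (Fin n) F} (h : IsConj x y) :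
    IsConj x.transpose y.transpose := by
  obtain ⟨c, rfl⟩ := isConj_iff.mp h
  refine isConj_iff.mpr ⟨(c⁻¹).transpose, ?_⟩
  have hm (a b : SpecialLinearGroup (Fin n) F) :
      (a * b).transpose = b.transpose * a.transpose :=
    Subtype.ext (by simp only [coe_transpose, coe_mul, transpose_mul])
  have hc : (c⁻¹).transpose * c.transpose = 1 := by
    rw [← hm, mul_inv_cancel]
    exact Subtype.ext (by simp)
  rw [hm, hm, ← mul_assoc, inv_eq_of_mul_eq_one_right hc]

/-- Interpolation by dot products. -/
theorem exists_dotProduct_eq {ι : Type*} {v : ι → Fin n → F} (hv : LinearIndependent F v)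
    (c : ι → F) : ∃ ψ : Fin n → F, ∀ i, ψ ⬝ᵥ v i = c i := by
  obtain ⟨f, hf⟩ := LinearMap.exists_extend ((Module.Basis.span hv).constr F c)
  refine ⟨(dotProductEquiv F (Fin n)).symm f, fun i => ?_⟩
  have h1 : ((dotProductEquiv F (Fin n)).symm f) ⬝ᵥ v i = f (v i) := by
    conv_rhs => rw [← (dotProductEquiv F (Fin n)).apply_symm_apply f]
    rfl
  have h2 := LinearMap.congr_fun hf (Module.Basis.span hv i)
  rw [Module.Basis.constr_basis, LinearMap.comp_apply, Submodule.subtype_apply,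
    Module.Basis.span_apply] at h2
  rw [h1, h2]

theorem exists_dotProduct_eq_one {b : Fin n → F} (hb : b ≠ 0) : ∃ ψ : Fin n → F, ψ ⬝ᵥ b = 1 := by
  obtain ⟨i, hi⟩ := Function.ne_iff.mp hb
  exact ⟨Pi.single i (b i)⁻¹, by simpa using inv_mul_cancel₀ hi⟩

/-- The subspace of vectors annihilated by a family of rows. -/
def ann {k : ℕ} (φ : Fin k → Fin n → F) : Submodule F (Fin n → F) :=
  LinearMap.ker (Matrix.mulVecLin (Matrix.of φ))

theorem mem_ann {k : ℕ} {φ : Fin k → Fin n → F} {v : Fin n → F} :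
    v ∈ ann φ ↔ ∀ j, φ j ⬝ᵥ v = 0 := by
  rw [ann, LinearMap.mem_ker, mulVecLin_apply, funext_iff]
  rfl

theorem le_finrank_ann {k : ℕ} (φ : Fin k → Fin n → F) : n - k ≤ Module.finrank F (ann φ) := by
  have h := LinearMap.finrank_range_add_finrank_ker (Matrix.mulVecLin (Matrix.of φ))
  have h2 := Submodule.finrank_le (LinearMap.range (Matrix.mulVecLin (Matrix.of φ)))
  rw [Module.finrank_fin_fun] at h h2
  change _ + Module.finrank F (ann φ) = n at h
  omega

theorem exists_ne_zero_of_lt {k : ℕ} (hk : k < n) (φ : Fin k → Fin n → F) :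
    ∃ v, v ≠ 0 ∧ ∀ j, φ j ⬝ᵥ v = 0 := by
  have h := le_finrank_ann φ
  have : 0 < Module.finrank F (ann φ) := by omega
  have := Module.finrank_pos_iff.mp this
  obtain ⟨⟨v, hv⟩, hne⟩ := exists_ne (0 : ann φ)
  exact ⟨v, fun h => hne (Subtype.ext h), mem_ann.mp hv⟩

theorem isConj_tv_of_linearIndependent {b b' φ : Fin n → F} (hb : φ ⬝ᵥ b = 0) (hb' : φ ⬝ᵥ b' = 0)
    (h : LinearIndependent F ![b, b']) : IsConj (tv b φ) (tv b' φ) := by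
  obtain ⟨ψ, hψ⟩ := exists_dotProduct_eq h ![1, 1]
  have h0 : ψ ⬝ᵥ b = 1 := hψ 0
  have h1 : ψ ⬝ᵥ b' = 1 := hψ 1
  have hd : ψ ⬝ᵥ (b' - b) = 0 := by rw [dotProduct_sub, h0, h1, sub_self]
  refine isConj_iff.mpr ⟨tv (b' - b) ψ, ?_⟩
  rw [conj_tv, tv_mulVec hd, h0, one_smul, add_sub_cancel, ← tv_neg hd, 
    vecMul_tv (by rw [dotProduct_neg, hd, neg_zero])]
  simp [hb, hb']

theorem linearIndependent_pair_of_dotProduct {b b' f : Fin n → F} (h : f ⬝ᵥ b ≠ 0)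
    (h' : f ⬝ᵥ b' = 0) (hb' : b' ≠ 0) : LinearIndependent F ![b, b'] := by
  rw [LinearIndependent.pair_iff]
  intro s t hst
  have h1 := congrArg (f ⬝ᵥ ·) hst
  simp [dotProduct_add, dotProduct_smul, h', h] at h1
  subst h1
  simpa [hb'] using hst

theorem isConj_tv_left (hn : 3 ≤ n) {b b' φ : Fin n → F} (hb : φ ⬝ᵥ b = 0) (hb' : φ ⬝ᵥ b' = 0)
    (h : b ≠ 0) (h' : b' ≠ 0) : IsConj (tv b φ) (tv b' φ) := by
  obtain ⟨f, hf⟩ := exists_dotProduct_eq_one h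
  by_cases hli : LinearIndependent F ![b, b']
  · exact isConj_tv_of_linearIndependent hb hb' hli
  obtain ⟨c, hc, hv⟩ := exists_ne_zero_of_lt (F := F) (show 2 < n by omega) ![φ, f]
  have hfb' : f ⬝ᵥ b' ≠ 0 := fun h0 =>
    hli (linearIndependent_pair_of_dotProduct (by rw [hf]; exact one_ne_zero) h0 h')
  have h1 : f ⬝ᵥ c = 0 := hv 1
  have h2 : φ ⬝ᵥ c = 0 := hv 0
  exact (isConj_tv_of_linearIndependent hb h2
    (linearIndependent_pair_of_dotProduct (by rw [hf]; exact one_ne_zero) h1 hc)).trans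
    (isConj_tv_of_linearIndependent hb' h2
      (linearIndependent_pair_of_dotProduct hfb' h1 hc)).symm

theorem isConj_tv_right (hn : 3 ≤ n) {b φ φ' : Fin n → F} (hb : φ ⬝ᵥ b = 0) (hb' : φ' ⬝ᵥ b = 0)
    (h : φ ≠ 0) (h' : φ' ≠ 0) : IsConj (tv b φ) (tv b φ') := by
  rw [dotProduct_comm] at hb hb'
  have := isConj_transpose (isConj_tv_left hn hb hb' h h')
  rwa [transpose_tv, transpose_tv] at this

/-- All nontrivial transvections are conjugate in `SL_n` for `n ≥ 3`. -/
theorem isConj_tv (hn : 3 ≤ n) {b φ b' φ' : Fin n → F} (hb : φ ⬝ᵥ b = 0) (hb' : φ' ⬝ᵥ b' = 0)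
    (h0 : b ≠ 0) (h1 : φ ≠ 0) (h0' : b' ≠ 0) (h1' : φ' ≠ 0) : IsConj (tv b φ) (tv b' φ') := by
  obtain ⟨c, hc, hv⟩ := exists_ne_zero_of_lt (F := F) (show 2 < n by omega) ![φ, φ']
  exact ((isConj_tv_left hn hb (hv 0) h0 hc).trans
    (isConj_tv_right hn (hv 0) (hv 1) h1 h1')).trans (isConj_tv_left hn (hv 1) hb' hc h0')

theorem transvection_eq_tv {i j : Fin n} (hij : i ≠ j) (c : F) :
    transvection hij c = tv (Pi.single i c) (Pi.single j 1) := by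
  refine Subtype.ext ?_
  rw [coe_tv (by simp [hij.symm]), transvection_coe]
  congr 1
  ext a b
  simp [vecMulVec_apply, single_apply, Pi.single_apply]
  grind

theorem diag2n_eq_prod {i j : Fin n} (hij : i ≠ j) {c : F} (hc : c ≠ 0) :
    diag2n hij c hc = transvection hij c * transvection hij.symm (-c⁻¹) * transvection hij c *
      transvection hij (-1) * transvection hij.symm 1 * transvection hij (-1) := by
  refine Subtype.ext ?_
  simp only [coe_mul, transvection_coe, mul_add, add_mul, mul_one, one_mul,
    single_mul_single_same, single_mul_single_of_ne _ _ _ _ hij,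
    single_mul_single_of_ne _ _ _ _ hij.symm, diag2n_coe, add_zero]
  ext a b
  simp only [Matrix.add_apply, single_apply, diagonal_apply, Matrix.one_apply]
  have := hij
  grind

/-- A homomorphism killing all elementary transvections is trivial. -/
theorem map_eq_one_of_transvection (hn : 2 ≤ n) {M : Type*} [Monoid M]
    (f : SpecialLinearGroup (Fin n) F →* M)
    (h : ∀ (i j : Fin n) (hij : i ≠ j) (a : F), f (transvection hij a) = 1)
    (g : SpecialLinearGroup (Fin n) F) : f g = 1 := by
  have : Nontrivial (Fin n) := Fin.nontrivial_iff_two_le.mpr hn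
  refine diagonal_transvection_induction' (fun g => f g = 1) g ?_ h ?_
  · intro i j hij c hc
    rw [diag2n_eq_prod]
    simp [h]
  · intro A B hA hB
    simp [hA, hB]

theorem diag2n_mul_transvection {i j : Fin n} (hij : i ≠ j) {s : F} (hs : s ≠ 0) (a : F) :
    diag2n hij s hs * transvection hij a = transvection hij (s * s * a) * diag2n hij s hs := by
  refine Subtype.ext ?_
  simp only [coe_mul, transvection_coe, mul_add, add_mul, mul_one, one_mul, diag2n_coe]
  congr 1
  ext k l
  simp only [diagonal_mul, mul_diagonal, single_apply]
  grind

theorem card_pow_le_card_ann [Fintype F] {k : ℕ} (φ : Fin k → Fin n → F) :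
    Fintype.card F ^ (n - k) ≤ Nat.card (ann φ) := by
  rw [Module.natCard_eq_pow_finrank (K := F), Nat.card_eq_fintype_card]
  exact Nat.pow_le_pow_right Fintype.card_pos (le_finrank_ann φ)

end Matrix.SpecialLinearGroup

theorem Matrix.exists_trace_eq_natCast {m : ℕ} {e : Matrix (Fin m) (Fin m) ℂ} (he : e * e = e) :
    ∃ N : ℕ, e.trace = N ∧ (e ≠ 0 → 1 ≤ N) := by
  have h : IsIdempotentElem (Matrix.toLin' e) := by
    rw [IsIdempotentElem, Module.End.mul_eq_comp, ← Matrix.toLin'_mul, he]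
  have htr : e.trace = Module.finrank ℂ (LinearMap.range (Matrix.toLin' e)) := by
    rw [← (LinearMap.IsIdempotentElem.isProj_range _ h).trace, Matrix.trace_toLin'_eq]
  refine ⟨_, htr, fun hne => ?_⟩
  rw [Nat.one_le_iff_ne_zero]
  intro h0
  rw [h0, Nat.cast_zero, ← Matrix.trace_toLin'_eq] at htr
  exact hne (Matrix.toLin'.injective (by
    rw [LinearMap.IsIdempotentElem.eq_zero_of_trace_eq_zero h htr, map_zero]))

namespace UnitaryDual

open Matrix

variable {G : Type*} [Group G] [Fintype G] (D : UnitaryDual G)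

/-- The isotypic projection attached to an additive character of an abelian subgroup. -/
noncomputable def isotypic {A : Type*} [AddCommGroup A] [Fintype A] (k : A → G) (i : Fin D.r)
    (χ : AddChar A ℂ) : Matrix (Fin (D.d i)) (Fin (D.d i)) ℂ :=
  (Fintype.card A : ℂ)⁻¹ • ∑ a, χ a • D.ρ i (k a)

variable {A : Type*} [AddCommGroup A] [Fintype A] (k : A → G)
  (hk : ∀ a b, k (a + b) = k a * k b) (i : Fin D.r)

theorem trace_isotypic (χ : AddChar A ℂ) : (D.isotypic k i χ).trace =
    (Fintype.card A : ℂ)⁻¹ * (D.d i * ∑ a, χ a * D.w i (k a)) := by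
  rw [isotypic, trace_smul, trace_sum, Finset.mul_sum, smul_eq_mul]
  congr 1
  refine Finset.sum_congr rfl fun a _ => ?_
  rw [trace_smul, ← d_mul_w, smul_eq_mul]
  ring

include hk in
theorem isotypic_mul_self (χ : AddChar A ℂ) :
    D.isotypic k i χ * D.isotypic k i χ = D.isotypic k i χ := by
  have hM : (Fintype.card A : ℂ) ≠ 0 := by simp
  have h1 : ∀ a, (χ a • D.ρ i (k a)) * ∑ m, χ m • D.ρ i (k m) = ∑ m, χ m • D.ρ i (k m) := by
    intro a
    rw [Finset.mul_sum]
    refine Fintype.sum_equiv (Equiv.addLeft a) _ _ fun m => ?_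
    rw [smul_mul_smul_comm, ← AddChar.map_add_eq_mul, ← map_mul, ← hk]
    rfl
  rw [isotypic, smul_mul_smul_comm, Finset.sum_mul, Finset.sum_congr rfl fun a _ => h1 a]
  simp only [Finset.sum_const, Finset.card_univ]
  rw [← Nat.cast_smul_eq_nsmul ℂ, smul_smul, mul_assoc, inv_mul_cancel₀ hM, mul_one]

include hk in
theorem sum_isotypic : ∑ χ, D.isotypic k i χ = 1 := by
  classical
  have hM : (Fintype.card A : ℂ) ≠ 0 := by simp
  have h0 : k 0 = 1 := by simpa using hk 0 0
  simp only [isotypic]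
  rw [← Finset.smul_sum, Finset.sum_comm]
  simp only [← Finset.sum_smul, AddChar.sum_apply_eq_ite, ite_smul, zero_smul]
  rw [Finset.sum_ite_eq' Finset.univ, if_pos (Finset.mem_univ _), smul_smul,
    inv_mul_cancel₀ hM, one_smul, h0, map_one]

include hk in
theorem mul_isotypic_zero (a : A) : D.ρ i (k a) * D.isotypic k i 0 = D.isotypic k i 0 := by
  rw [isotypic, mul_smul_comm, Finset.mul_sum]
  congr 1
  refine Fintype.sum_equiv (Equiv.addLeft a) _ _ fun m => ?_
  rw [mul_smul_comm, ← map_mul, ← hk]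
  simp

include hk in
/-- A lower bound for the degree in terms of the size of the orbits on nontrivial characters of
an abelian subgroup. -/
theorem le_d_of_forall_addChar {a₀ : A} (ha₀ : D.ρ i (k a₀) ≠ 1) (K : ℕ)
    (hK : ∀ χ : AddChar A ℂ, χ ≠ 0 → ∃ J : Finset (AddChar A ℂ),
      (∀ χ' ∈ J, ∑ a, χ' a * D.w i (k a) = ∑ a, χ a * D.w i (k a)) ∧ K ≤ J.card) :
    K ≤ D.d i := by
  classical
  choose N hN hN1 using fun χ => Matrix.exists_trace_eq_natCast (D.isotypic_mul_self k hk i χ)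
  have hsum : ∑ χ, N χ = D.d i := by
    have h := congrArg Matrix.trace (D.sum_isotypic k hk i)
    rw [trace_sum, trace_one, Fintype.card_fin, Finset.sum_congr rfl fun χ _ => hN χ] at h
    exact_mod_cast h
  obtain ⟨χ, hχ, hne⟩ : ∃ χ : AddChar A ℂ, χ ≠ 0 ∧ D.isotypic k i χ ≠ 0 := by
    by_contra! hcon
    have h := D.sum_isotypic k hk i
    rw [Fintype.sum_eq_single 0 hcon] at h
    have h2 := D.mul_isotypic_zero k hk i a₀
    rw [h, mul_one] at h2
    exact ha₀ h2
  obtain ⟨J, hJ, hKJ⟩ := hK χ hχ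
  have hNJ : ∀ χ' ∈ J, 1 ≤ N χ' := by
    intro χ' hχ'
    have : N χ' = N χ := by
      have : ((N χ' : ℕ) : ℂ) = N χ := by
        rw [← hN, ← hN, trace_isotypic, trace_isotypic, hJ χ' hχ']
      exact_mod_cast this
    rw [this]
    exact hN1 χ hne
  calc K ≤ J.card := hKJ
    _ = ∑ χ' ∈ J, 1 := by simp
    _ ≤ ∑ χ' ∈ J, N χ' := Finset.sum_le_sum hNJ
    _ ≤ ∑ χ', N χ' := Finset.sum_le_sum_of_subset (Finset.subset_univ J)
    _ = D.d i := hsum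

end UnitaryDual

namespace UnitaryDual

open Matrix SpecialLinearGroup

variable {n : ℕ} {F : Type*} [Field F] [Fintype F] [DecidableEq F]
  (D : UnitaryDual (SpecialLinearGroup (Fin n) F))

theorem w_eq_of_isConj {i : Fin D.r} {x y : SpecialLinearGroup (Fin n) F} (h : IsConj x y) :
    D.w i x = D.w i y := by
  obtain ⟨c, rfl⟩ := isConj_iff.mp h
  rw [w_conj]

/-- The common value of a normalized character on nontrivial transvections. -/
theorem exists_w_tv_eq (hn : 3 ≤ n) (i : Fin D.r) : ∃ θ : ℝ, |θ| ≤ 1 ∧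
    ∀ b φ : Fin n → F, φ ⬝ᵥ b = 0 → b ≠ 0 → φ ≠ 0 → D.w i (tv b φ) = θ := by
  set b₀ : Fin n → F := Pi.single ⟨0, by omega⟩ 1
  set φ₀ : Fin n → F := Pi.single ⟨1, by omega⟩ 1
  have h0 : φ₀ ⬝ᵥ b₀ = 0 := by simp [b₀, φ₀]
  have hb : b₀ ≠ 0 := by simp [b₀]
  have hφ : φ₀ ≠ 0 := by simp [φ₀]
  have hall : ∀ b φ : Fin n → F, φ ⬝ᵥ b = 0 → b ≠ 0 → φ ≠ 0 →
      D.w i (tv b φ) = D.w i (tv b₀ φ₀) := fun b φ h hb' hφ' =>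
    D.w_eq_of_isConj (isConj_tv hn h h0 hb' hφ' hb hφ)
  have hreal : ((D.w i (tv b₀ φ₀)).re : ℂ) = D.w i (tv b₀ φ₀) := by
    rw [← Complex.conj_eq_iff_re]
    have h1 := hall (-b₀) φ₀ (by rw [dotProduct_neg, h0, neg_zero]) (neg_ne_zero.mpr hb) hφ
    rwa [tv_neg h0, w_inv] at h1
  refine ⟨(D.w i (tv b₀ φ₀)).re, (Complex.abs_re_le_norm _).trans (D.norm_w_le_one i _), ?_⟩
  intro b φ h hb' hφ'
  rw [hall b φ h hb' hφ', hreal]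

theorem exists_transvection_of_mem_nontriv (hn : 2 ≤ n) {i : Fin D.r} (hi : i ∈ D.nontriv) :
    ∃ (k l : Fin n) (hkl : k ≠ l) (a : F), D.ρ i (transvection hkl a) ≠ 1 := by
  by_contra! hcon
  obtain ⟨g, hg⟩ := D.mem_nontriv.mp hi
  exact hg (map_eq_one_of_transvection hn (D.ρ i) hcon g)

theorem half_card_le_d (hn : 2 ≤ n) {i : Fin D.r} (hi : i ∈ D.nontriv) :
    Fintype.card F / 2 ≤ D.d i := by
  classical
  obtain ⟨k, l, hkl, a₀, ha₀⟩ := D.exists_transvection_of_mem_nontriv hn hi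
  refine D.le_d_of_forall_addChar (fun a : F => transvection hkl a) (transvection_add hkl) i
    ha₀ _ fun χ hχ => ?_
  have hinj : ∀ r s : F, χ.mulShift r = χ.mulShift s → r = s := by
    intro r s hrs
    by_contra hne
    refine hχ ((χ.mulShift_unit_eq_one_iff (sub_ne_zero.mpr hne).isUnit).mp ?_)
    ext x
    have h1 := DFunLike.congr_fun hrs x
    rw [AddChar.mulShift_apply, AddChar.mulShift_apply] at h1
    rw [AddChar.mulShift_apply, sub_mul, AddChar.map_sub_eq_div, h1, AddChar.one_apply]
    exact div_self (χ.val_isUnit _).ne_zero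
  have hw (s a : F) (hs : s ≠ 0) :
      D.w i (transvection hkl (s * s * a)) = D.w i (transvection hkl a) := by
    rw [← D.w_conj i (diag2n hkl s hs) (transvection hkl a), diag2n_mul_transvection,
      mul_inv_cancel_right]
  refine ⟨(Finset.univ.erase (0 : F)).image fun s => χ.mulShift (s * s), ?_, ?_⟩
  · intro χ' hχ'
    obtain ⟨s, hs, rfl⟩ := Finset.mem_image.mp hχ'
    have hs0 := Finset.ne_of_mem_erase hs
    refine Fintype.sum_equiv (Equiv.mulLeft₀ (s * s) (mul_ne_zero hs0 hs0)) _ _ fun a => ?_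
    change _ = χ (s * s * a) * D.w i (transvection hkl (s * s * a))
    rw [AddChar.mulShift_apply, hw s a hs0]
  · have h := Finset.card_le_mul_card_image (f := fun s => χ.mulShift (s * s))
      (Finset.univ.erase (0 : F)) 2 ?_
    · rw [Finset.card_erase_of_mem (Finset.mem_univ _), Finset.card_univ] at h
      omega
    · intro χ' hχ'
      obtain ⟨s, hs, rfl⟩ := Finset.mem_image.mp hχ'
      refine (Finset.card_le_card (t := {s, -s}) fun r hr => ?_).trans Finset.card_le_two
      rw [Finset.mem_filter] at hr
      have := hinj _ _ hr.2
      rw [mul_self_eq_mul_self_iff] at this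
      simpa using this

theorem card_pow_le_d_add_one (hn : 3 ≤ n) {i : Fin D.r} (hi : i ∈ D.nontriv) :
    Fintype.card F ^ (n - 1) - 1 ≤ D.d i := by
  classical
  obtain ⟨k, l, hkl, a₀, ha₀⟩ := D.exists_transvection_of_mem_nontriv (by omega) hi
  obtain ⟨θ, -, hθ⟩ := D.exists_w_tv_eq hn i
  set φ : Fin n → F := Pi.single l 1
  set A := ann fun _ : Fin 1 => φ
  have : Fintype A := Fintype.ofFinite A
  have hA (a : A) : φ ⬝ᵥ a.1 = 0 := mem_ann.mp a.2 0
  have hφ : φ ≠ 0 := by simp [φ]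
  have hmem : Pi.single k a₀ ∈ A := mem_ann.mpr fun _ => by simp [φ, hkl]
  refine D.le_d_of_forall_addChar (fun a : A => tv a.1 φ) (fun a b => tv_add (hA a) (hA b)) i
    (a₀ := ⟨_, hmem⟩) (by rwa [← transvection_eq_tv]) _ fun χ hχ => ?_
  have hsum : ∀ χ : AddChar A ℂ, χ ≠ 0 → ∑ a, χ a * D.w i (tv a.1 φ) = 1 - θ := by
    intro χ hχ
    have h0 : ∑ a, χ a = 0 := by rw [AddChar.sum_eq_ite, if_neg hχ]
    rw [← Finset.add_sum_erase _ _ (Finset.mem_univ (0 : A))] at h0 ⊢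
    rw [Finset.sum_congr rfl fun a ha => by
      rw [hθ a.1 φ (hA a) (by simpa using Finset.ne_of_mem_erase ha) hφ], ← Finset.sum_mul]
    rw [AddChar.map_zero_eq_one] at h0 ⊢
    rw [Submodule.coe_zero, tv_zero, w_one, eq_neg_of_add_eq_zero_right h0]
    ring
  refine ⟨Finset.univ.erase 0, fun χ' hχ' => ?_, ?_⟩
  · rw [hsum χ hχ, hsum χ' (Finset.ne_of_mem_erase hχ')]
  · rw [Finset.card_erase_of_mem (Finset.mem_univ _), Finset.card_univ, AddChar.card_eq]
    have h := card_pow_le_card_ann (F := F) fun _ : Fin 1 => φ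
    rw [Nat.card_eq_fintype_card] at h
    exact Nat.sub_le_sub_right h 1

/-- A lower bound for the degrees of the nontrivial irreducible representations of `SL_n`. -/
theorem card_pow_le_d (hn : 2 ≤ n) {i : Fin D.r} (hi : i ∈ D.nontriv) :
    (Fintype.card F : ℝ) ^ (n - 1) ≤ 4 * D.d i := by
  have hq : 2 ≤ Fintype.card F := Fintype.one_lt_card
  have : Fintype.card F ^ (n - 1) ≤ 4 * D.d i := by
    rcases hn.eq_or_lt with rfl | h3
    · have := D.half_card_le_d le_rfl hi
      rw [show 2 - 1 = 1 from rfl, pow_one]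
      omega
    · have := D.card_pow_le_d_add_one h3 hi
      have h1 := Nat.pow_le_pow_right (n := Fintype.card F) Fintype.card_pos
        (show 1 ≤ n - 1 by omega)
      rw [pow_one] at h1
      omega
  exact_mod_cast this

end UnitaryDual

namespace Matrix.SpecialLinearGroup

variable {n : ℕ} {F : Type*} [Field F]

theorem eq_of_vecMul_eq {x c c' : Matrix (Fin n) (Fin n) F} {ψ : Fin n → F}
    (hψ : ∀ b, (∀ k : ℕ, ψ ⬝ᵥ ((x ^ k) *ᵥ b) = 0) → b = 0) (hc : Commute c x) (hc' : Commute c' x)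
    (h : ψ ᵥ* c = ψ ᵥ* c') : c = c' := by
  rw [← sub_eq_zero]
  refine Matrix.ext_of_mulVec_single fun i => ?_
  rw [zero_mulVec]
  refine hψ _ fun k => ?_
  rw [mulVec_mulVec, ← ((hc.sub_left hc').pow_right k).eq, ← mulVec_mulVec, dotProduct_mulVec,
    vecMul_sub, h, sub_self, zero_dotProduct]

/-- A bound for the centralizer of an element with a cyclic row vector. -/
theorem card_centralizer_le [Fintype F] [DecidableEq F] (hn : 0 < n)
    {x : SpecialLinearGroup (Fin n) F} {ψ : Fin n → F}
    (hψ : ∀ b, (∀ k : ℕ, ψ ⬝ᵥ ((x ^ k).1 *ᵥ b) = 0) → b = 0) :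
    (Fintype.card F - 1) * Nat.card {c : SpecialLinearGroup (Fin n) F // c * x = x * c} ≤
      n * Fintype.card F ^ n := by
  classical
  have hψ' : ∀ b, (∀ k : ℕ, ψ ⬝ᵥ ((x.1 ^ k) *ᵥ b) = 0) → b = 0 := by simpa using hψ
  set C := {c : SpecialLinearGroup (Fin n) F // c * x = x * c}
  have hC (c : C) : Commute c.1.1 x.1 := by
    have := congrArg Subtype.val c.2
    rwa [coe_mul, coe_mul] at this
  set f : Fˣ × C → (Fin n → F) := fun p => ψ ᵥ* ((p.1 : F) • p.2.1.1) with hf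
  have key : ∀ p p₀ : Fˣ × C, f p = f p₀ → (p.1 : F) • p.2.1.1 = (p₀.1 : F) • p₀.2.1.1 := by
    intro p p₀ h
    exact eq_of_vecMul_eq hψ' ((hC _).smul_left _) ((hC _).smul_left _) h
  have h := Finset.card_le_mul_card_image (f := f) Finset.univ n ?_
  · rw [Finset.card_univ, Fintype.card_prod, Fintype.card_units] at h
    rw [Nat.card_eq_fintype_card]
    refine h.trans (Nat.mul_le_mul_left n ((Finset.card_le_univ _).trans ?_))
    simp
  · intro v hv
    obtain ⟨p₀, -, hp₀⟩ := Finset.mem_image.mp hv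
    have hmaps : ∀ p ∈ Finset.univ.filter (fun p => f p = v),
        (p₀.1 : F) / p.1 ∈ (Polynomial.nthRoots n (1 : F)).toFinset := by
      intro p hp
      have h1 := congrArg det (key p p₀ ((Finset.mem_filter.mp hp).2.trans hp₀.symm))
      rw [det_smul, det_smul, det_coe, det_coe, mul_one, mul_one, Fintype.card_fin] at h1
      rw [Multiset.mem_toFinset, Polynomial.mem_nthRoots hn, div_pow, h1]
      exact div_self (pow_ne_zero _ p₀.1.ne_zero)
    refine (Finset.card_le_card_of_injOn _ hmaps ?_).trans
      ((Multiset.toFinset_card_le _).trans (Polynomial.card_nthRoots n 1))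
    intro p hp p' hp' hpp
    have h1 : p.1 = p'.1 := by
      have h2 : (p₀.1 : F) / p.1 = p₀.1 / p'.1 := hpp
      rw [div_eq_div_iff p.1.ne_zero p'.1.ne_zero, mul_right_inj' p₀.1.ne_zero] at h2
      exact Units.ext h2.symm
    have h3 := key p p' (((Finset.mem_filter.mp hp).2).trans ((Finset.mem_filter.mp hp').2).symm)
    rw [h1] at h3
    exact Prod.ext h1 (Subtype.ext (Subtype.ext
      (smul_right_injective (Matrix (Fin n) (Fin n) F) p'.1.ne_zero h3)))

end Matrix.SpecialLinearGroup

namespace UnitaryDual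

open Matrix SpecialLinearGroup

variable {n : ℕ} {F : Type*} [Field F] [Fintype F] [DecidableEq F]
  (D : UnitaryDual (SpecialLinearGroup (Fin n) F))

theorem sum_nontriv_le_of_cyclic (hn : 2 ≤ n) {x : SpecialLinearGroup (Fin n) F} {ψ : Fin n → F}
    (hψ : ∀ b, (∀ k : ℕ, ψ ⬝ᵥ ((x ^ k).1 *ᵥ b) = 0) → b = 0) {t : ℕ} (ht : 2 * n + 3 ≤ t) :
    ∑ i ∈ D.nontriv, (D.d i : ℝ) ^ 2 * (‖D.w i x‖ ^ t) ^ 2 ≤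
      (32 * n) ^ (2 * n + 3) / Fintype.card F := by
  have hq : (2 : ℝ) ≤ (Fintype.card F : ℝ) := by
    exact_mod_cast (Fintype.one_lt_card : 1 < Fintype.card F)
  have hsum := D.sum_sq_mul_norm_sq_eq_card x
  have h' : ((Fintype.card F : ℝ) - 1) *
      (Nat.card {c : SpecialLinearGroup (Fin n) F // c * x = x * c} : ℝ) ≤
      n * (Fintype.card F : ℝ) ^ n := by
    have : ((Fintype.card F - 1 : ℕ) : ℝ) = (Fintype.card F : ℝ) - 1 := by
      rw [Nat.cast_sub Fintype.card_pos, Nat.cast_one]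
    rw [← this]
    exact_mod_cast card_centralizer_le (by omega) hψ
  set q : ℝ := (Fintype.card F : ℝ)
  set M : ℝ := (Nat.card {c : SpecialLinearGroup (Fin n) F // c * x = x * c} : ℝ)
  have hM : M ≤ 2 * n * q ^ (n - 1) := by
    have hM0 : 0 ≤ M := Nat.cast_nonneg _
    rw [← Nat.sub_add_cancel (show 1 ≤ n by omega), pow_succ] at h'
    rw [Nat.sub_add_cancel (show 1 ≤ n by omega)] at h'
    have h2 : q * M ≤ q * (2 * n * q ^ (n - 1)) := by nlinarith
    exact le_of_mul_le_mul_left h2 (by linarith)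
  have hQ1 : 1 ≤ q ^ (n - 1) := one_le_pow₀ (by linarith)
  have hw : ∀ i ∈ D.nontriv, ‖D.w i x‖ ^ 2 ≤ 32 * n / q ^ (n - 1) := by
    intro i hi
    have hd := D.card_pow_le_d hn hi
    have h1 : (D.d i : ℝ) ^ 2 * ‖D.w i x‖ ^ 2 ≤ 2 * n * q ^ (n - 1) := by
      refine le_trans ?_ hM
      rw [← hsum]
      exact Finset.single_le_sum (f := fun i => (D.d i : ℝ) ^ 2 * ‖D.w i x‖ ^ 2)
        (fun j _ => by positivity) (Finset.mem_univ i)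
    rw [le_div_iff₀ (by positivity)]
    have h2 : (q ^ (n - 1)) ^ 2 ≤ 16 * (D.d i : ℝ) ^ 2 := by
      nlinarith [Nat.cast_nonneg (α := ℝ) (D.d i)]
    have h3 : (q ^ (n - 1)) ^ 2 * ‖D.w i x‖ ^ 2 ≤ 32 * n * q ^ (n - 1) := by
      nlinarith [sq_nonneg ‖D.w i x‖]
    refine le_of_mul_le_mul_left ?_ (show 0 < q ^ (n - 1) by positivity)
    nlinarith
  have hn0 : (2 : ℝ) ≤ n := by exact_mod_cast hn
  have step : ∀ i ∈ D.nontriv, (D.d i : ℝ) ^ 2 * (‖D.w i x‖ ^ t) ^ 2 ≤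
      (32 * n / q ^ (n - 1)) ^ (2 * n + 2) * ((D.d i : ℝ) ^ 2 * ‖D.w i x‖ ^ 2) := by
    intro i hi
    have h1 : (‖D.w i x‖ ^ t) ^ 2 ≤ (‖D.w i x‖ ^ 2) ^ (2 * n + 2) * ‖D.w i x‖ ^ 2 := by
      rw [← pow_succ, ← pow_mul, ← pow_mul]
      exact pow_le_pow_of_le_one (norm_nonneg _) (D.norm_w_le_one i x) (by omega)
    have h2 := pow_le_pow_left₀ (by positivity) (hw i hi) (2 * n + 2)
    calc (D.d i : ℝ) ^ 2 * (‖D.w i x‖ ^ t) ^ 2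
        ≤ (D.d i : ℝ) ^ 2 * ((‖D.w i x‖ ^ 2) ^ (2 * n + 2) * ‖D.w i x‖ ^ 2) := by gcongr
      _ ≤ (D.d i : ℝ) ^ 2 * ((32 * n / q ^ (n - 1)) ^ (2 * n + 2) * ‖D.w i x‖ ^ 2) := by gcongr
      _ = _ := by ring
  calc _ ≤ ∑ i ∈ D.nontriv,
        (32 * n / q ^ (n - 1)) ^ (2 * n + 2) * ((D.d i : ℝ) ^ 2 * ‖D.w i x‖ ^ 2) :=
        Finset.sum_le_sum step
    _ ≤ (32 * n / q ^ (n - 1)) ^ (2 * n + 2) * M := by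
        rw [← Finset.mul_sum]
        refine mul_le_mul_of_nonneg_left ?_ (by positivity)
        rw [← hsum]
        exact Finset.sum_le_sum_of_subset_of_nonneg (Finset.subset_univ _)
          fun _ _ _ => by positivity
    _ ≤ (32 * n / q ^ (n - 1)) ^ (2 * n + 2) * (32 * n * q ^ (n - 1)) := by
        gcongr
        refine hM.trans ?_
        gcongr
        norm_num
    _ = (32 * n) ^ (2 * n + 3) / (q ^ (n - 1)) ^ (2 * n + 1) := by
        rw [div_pow, pow_succ (q ^ (n - 1)), pow_succ (32 * (n : ℝ)) (2 * n + 2)]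
        field_simp
    _ ≤ (32 * n) ^ (2 * n + 3) / q := by
        gcongr
        rw [← pow_mul]
        exact le_self_pow₀ (by linarith) (Nat.mul_ne_zero (by omega) (by omega))

end UnitaryDual

namespace Matrix.SpecialLinearGroup

variable {n : ℕ} {F : Type*} [Field F]

theorem exists_linearIndependent_vecMul {x : SpecialLinearGroup (Fin n) F}
    (hx : x ∉ Subgroup.center (SpecialLinearGroup (Fin n) F)) :
    ∃ ψ : Fin n → F, LinearIndependent F ![ψ, ψ ᵥ* x.1] := by
  by_contra! hcon
  have hev : ∀ ψ : Fin n → F, ψ ≠ 0 → ∃ a : F, a • ψ = ψ ᵥ* x.1 := fun ψ h0 => by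
    have := hcon ψ
    rw [LinearIndependent.pair_iff' h0] at this
    push Not at this
    exact this
  have hoff : ∀ k l, l ≠ k → x.1 k l = 0 := by
    intro k l hkl
    obtain ⟨a, ha⟩ := hev (Pi.single k 1) (by simp)
    have := congrFun ha l
    simpa [hkl] using this.symm
  have hdiag : ∀ k l, x.1 k k = x.1 l l := by
    intro k l
    by_cases hkl : k = l
    · rw [hkl]
    obtain ⟨a, ha⟩ := hev (Pi.single k 1 + Pi.single l 1) (by
      intro h
      have := congrFun h k
      simp [hkl] at this)
    have h1 := congrFun ha k
    have h2 := congrFun ha l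
    simp [add_vecMul, hkl, Ne.symm hkl, hoff k l (Ne.symm hkl), hoff l k hkl] at h1 h2
    rw [← h1, ← h2]
  apply hx
  rcases n.eq_zero_or_pos with rfl | hn
  · have : x = 1 := Subtype.ext (Subsingleton.elim _ _)
    rw [this]
    exact Subgroup.one_mem _
  · have hs : scalar (Fin n) (x.1 ⟨0, hn⟩ ⟨0, hn⟩) = x.1 := by
      ext k l
      rw [scalar_apply, diagonal_apply]
      split_ifs with h
      · rw [← h, hdiag]
      · rw [hoff k l (Ne.symm h)]
    refine mem_center_iff.mpr ⟨_, ?_, hs⟩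
    have := x.2
    rwa [← hs, scalar_apply, det_diagonal, Finset.prod_const, Finset.card_univ] at this

theorem tv_mul_tv_right {b φ φ' : Fin n → F} (h : φ ⬝ᵥ b = 0) (h' : φ' ⬝ᵥ b = 0) :
    tv b φ * tv b φ' = tv b (φ + φ') := by
  refine Subtype.ext ?_
  rw [coe_mul, coe_tv h, coe_tv h', coe_tv (by rw [add_dotProduct, h, h', add_zero]),
    vecMulVec_add, mul_add, add_mul, add_mul, vecMulVec_mul_vecMulVec, h]
  simp [add_assoc]

theorem tv_smul (a : F) {b φ : Fin n → F} (h : φ ⬝ᵥ b = 0) : tv (a • b) φ = tv b (a • φ) := by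
  refine Subtype.ext ?_
  rw [coe_tv (by rw [dotProduct_smul, h, smul_zero]),
    coe_tv (by rw [smul_dotProduct, h, smul_zero]),
    smul_vecMulVec, vecMulVec_smul]

theorem tv_conj_tv {b φ : Fin n → F} (h : φ ⬝ᵥ b = 0) (c ψ : Fin n → F) :
    tv b φ * tv c ψ * (tv b φ)⁻¹ = tv (c + (φ ⬝ᵥ c) • b) (ψ - (ψ ⬝ᵥ b) • φ) := by
  rw [conj_tv, tv_mulVec h, ← tv_neg h, vecMul_tv (by rw [dotProduct_neg, h, neg_zero]),
    dotProduct_neg, neg_smul, ← sub_eq_add_neg]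

theorem commute_tv {b φ c ψ : Fin n → F} (h : φ ⬝ᵥ b = 0) (h1 : φ ⬝ᵥ c = 0) (h2 : ψ ⬝ᵥ b = 0) :
    Commute (tv b φ) (tv c ψ) := by
  have := tv_conj_tv h c ψ
  rw [h1, h2, zero_smul, zero_smul, add_zero, sub_zero, mul_inv_eq_iff_eq_mul] at this
  exact this

theorem card_pow_le_card_ann_of_ne_zero [Fintype F] {k : ℕ} (φ : Fin k → Fin n → F)
    {b : Fin n → F} (hb : b ≠ 0) (h : ∀ j, φ j ⬝ᵥ b = 0) :
    Fintype.card F ^ max 1 (n - k) ≤ Nat.card (ann φ) := by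
  rw [Module.natCard_eq_pow_finrank (K := F), Nat.card_eq_fintype_card]
  refine Nat.pow_le_pow_right Fintype.card_pos (max_le ?_ (le_finrank_ann φ))
  have : Nontrivial (ann φ) := ⟨⟨b, mem_ann.mpr h⟩, 0, fun h0 => hb (congrArg Subtype.val h0)⟩
  exact Module.finrank_pos

end Matrix.SpecialLinearGroup

namespace UnitaryDual

open Matrix SpecialLinearGroup

theorem norm_w_le_of_forall {G : Type*} [Group G] [Fintype G] (D : UnitaryDual G)
    {M : Type*} [AddCommGroup M] [Fintype M] (k h : M → G) (x : G)
    (hk : ∀ a b, k (a + b) = k a * k b) (hc : ∀ a, k a = h a * x * (h a)⁻¹ * x⁻¹)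
    (i : Fin D.r) {β : ℝ} (hβ : 0 ≤ β) (hw : ∀ m, m ≠ 0 → ‖D.w i (k m)‖ ≤ β) {K : ℝ}
    (hK0 : 0 < K) (hK : K ≤ Fintype.card M) :
    ‖D.w i x‖ ≤ 1 / K + β := by
  classical
  have hM : (0 : ℝ) < Fintype.card M := hK0.trans_le hK
  refine (D.norm_w_le_avg k h x hk hc i).trans ?_
  have h1 : ∑ m, ‖D.w i (k m)‖ ≤ 1 + Fintype.card M * β := by
    rw [← Finset.add_sum_erase _ _ (Finset.mem_univ (0 : M))]
    refine add_le_add (D.norm_w_le_one _ _) ?_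
    refine (Finset.sum_le_card_nsmul _ _ β fun m hm => hw m (Finset.ne_of_mem_erase hm)).trans ?_
    rw [nsmul_eq_mul]
    refine mul_le_mul_of_nonneg_right ?_ hβ
    exact_mod_cast Finset.card_le_univ _
  calc _ ≤ (Fintype.card M : ℝ)⁻¹ * (1 + Fintype.card M * β) := by gcongr
    _ = 1 / Fintype.card M + β := by field_simp
    _ ≤ 1 / K + β := by gcongr

variable {n : ℕ} {F : Type*} [Field F] [Fintype F] [DecidableEq F]
  (D : UnitaryDual (SpecialLinearGroup (Fin n) F))

theorem norm_w_le_of_forall_ann (i : Fin D.r) (x : SpecialLinearGroup (Fin n) F)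
    (φ : Fin 3 → Fin n → F) (k h : (Fin n → F) → SpecialLinearGroup (Fin n) F)
    (hk : ∀ a ∈ ann φ, ∀ b ∈ ann φ, k (a + b) = k a * k b)
    (hc : ∀ a ∈ ann φ, k a = h a * x * (h a)⁻¹ * x⁻¹)
    {β : ℝ} (hβ : 0 ≤ β) (hw : ∀ a ∈ ann φ, a ≠ 0 → ‖D.w i (k a)‖ ≤ β)
    {b : Fin n → F} (hb : b ≠ 0) (hb' : ∀ j, φ j ⬝ᵥ b = 0) :
    ‖D.w i x‖ ≤ 1 / (Fintype.card F : ℝ) ^ max 1 (n - 3) + β := by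
  have : Fintype (ann φ) := Fintype.ofFinite _
  refine D.norm_w_le_of_forall (fun a : ann φ => k a.1) (fun a : ann φ => h a.1) x
    (fun a b => hk _ a.2 _ b.2) (fun a => hc _ a.2) i hβ
    (fun a ha => hw _ a.2 fun h0 => ha (Subtype.ext h0)) ?_ ?_
  · exact pow_pos (by exact_mod_cast Fintype.card_pos) _
  · have := card_pow_le_card_ann_of_ne_zero φ hb hb'
    rw [Nat.card_eq_fintype_card] at this
    exact_mod_cast this

/-- Two commutations bound the character values of an element without cyclic vectors by those
of transvections. -/
theorem norm_w_le_of_not_cyclic {x : SpecialLinearGroup (Fin n) F}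
    (hx : x ∉ Subgroup.center (SpecialLinearGroup (Fin n) F))
    (hc : ∀ ψ : Fin n → F, ∃ b, b ≠ 0 ∧ ∀ k : ℕ, ψ ⬝ᵥ ((x ^ k).1 *ᵥ b) = 0)
    {i : Fin D.r} {θ : ℝ}
    (hθ : ∀ b φ : Fin n → F, φ ⬝ᵥ b = 0 → b ≠ 0 → φ ≠ 0 → D.w i (tv b φ) = θ) :
    ‖D.w i x‖ ≤ 2 / (Fintype.card F : ℝ) ^ max 1 (n - 3) + |θ| := by
  have hq : 0 < 1 / (Fintype.card F : ℝ) ^ max 1 (n - 3) :=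
    one_div_pos.mpr (pow_pos (by exact_mod_cast Fintype.card_pos) _)
  obtain ⟨ψ, hψ⟩ := exists_linearIndependent_vecMul (x := x⁻¹) (fun h => hx (by simpa using h))
  set ψ' := ψ ᵥ* (x⁻¹).1 with hψ'
  have hψ0 : ψ ≠ 0 := hψ.ne_zero 0
  obtain ⟨b₀, hb₀, hb₀'⟩ := hc ψ
  have hxx (v : Fin n → F) : ψ' ⬝ᵥ (x.1 *ᵥ v) = ψ ⬝ᵥ v := by
    rw [hψ', dotProduct_mulVec, vecMul_vecMul, ← Matrix.SpecialLinearGroup.coe_mul, inv_mul_cancel,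
      Matrix.SpecialLinearGroup.coe_one, vecMul_one]
  have hinv : x⁻¹ = x ^ (orderOf x - 1) := by
    rw [inv_eq_iff_mul_eq_one, ← pow_succ', Nat.sub_add_cancel (orderOf_pos x), pow_orderOf_eq_one]
  set φ : Fin 3 → Fin n → F := ![ψ, ψ ᵥ* x.1, ψ'] with hφ
  have hφ0 {a : Fin n → F} (ha : a ∈ ann φ) : ψ ⬝ᵥ a = 0 := mem_ann.mp ha 0
  have hφ1 {a : Fin n → F} (ha : a ∈ ann φ) : ψ ⬝ᵥ (x.1 *ᵥ a) = 0 := by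
    rw [dotProduct_mulVec]
    exact mem_ann.mp ha 1
  have hφ2 {a : Fin n → F} (ha : a ∈ ann φ) : ψ' ⬝ᵥ a = 0 := mem_ann.mp ha 2
  have hneg {a : Fin n → F} (ha : a ∈ ann φ) : ψ' ⬝ᵥ (x.1 *ᵥ (-a)) = 0 := by
    rw [hxx, dotProduct_neg, hφ0 ha, neg_zero]
  have hneg' {a : Fin n → F} (ha : a ∈ ann φ) : ψ ⬝ᵥ (x.1 *ᵥ (-a)) = 0 := by
    rw [mulVec_neg, dotProduct_neg, hφ1 ha, neg_zero]
  have main := D.norm_w_le_of_forall_ann i x φ (fun a => tv a ψ * tv (x.1 *ᵥ (-a)) ψ')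
    (fun a => tv a ψ) ?_ ?_ (β := 1 / (Fintype.card F : ℝ) ^ max 1 (n - 3) + |θ|)
    (by positivity) ?_ hb₀ ?_
  · refine main.trans_eq ?_
    ring
  · intro a ha b hb
    rw [neg_add, mulVec_add, tv_add (hφ0 ha) (hφ0 hb), tv_add (hneg ha) (hneg hb), mul_assoc,
      mul_assoc, ← mul_assoc (tv b ψ), (commute_tv (hφ0 hb) (hneg' ha) (hφ2 hb)).eq, mul_assoc]
  · intro a ha
    rw [mul_assoc (tv a ψ), mul_assoc (tv a ψ), ← tv_neg (hφ0 ha), conj_tv]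
  · intro a ha ha0
    by_cases hli : LinearIndependent F ![a, x.1 *ᵥ a]
    · obtain ⟨f, hf⟩ := exists_dotProduct_eq hli ![1, 0]
      have hf0 : f ⬝ᵥ a = 1 := hf 0
      have hf1 : f ⬝ᵥ (x.1 *ᵥ a) = 0 := hf 1
      have h0 {c : Fin n → F} (hcm : c ∈ ann ![ψ, ψ', f]) : ψ ⬝ᵥ c = 0 := mem_ann.mp hcm 0
      have h1 {c : Fin n → F} (hcm : c ∈ ann ![ψ, ψ', f]) : ψ' ⬝ᵥ c = 0 := mem_ann.mp hcm 1
      have h2 {c : Fin n → F} (hcm : c ∈ ann ![ψ, ψ', f]) : f ⬝ᵥ c = 0 := mem_ann.mp hcm 2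
      refine D.norm_w_le_of_forall_ann i _ ![ψ, ψ', f] (fun c => tv c ψ) (fun c => tv c f)
        (fun c hcm d hdm => tv_add (h0 hcm) (h0 hdm)) ?_ (abs_nonneg θ) ?_
        (b := x.1 *ᵥ a) (hli.ne_zero 1) ?_
      · intro c hcm
        rw [eq_mul_inv_iff_mul_eq, ← conj_mul, tv_conj_tv (h2 hcm), tv_conj_tv (h2 hcm),
          h0 hcm, h1 hcm, hf0, mulVec_neg, dotProduct_neg, hf1]
        simp only [neg_zero, zero_smul, add_zero, sub_zero, one_smul]
        rw [← mul_assoc, ← tv_add (h0 hcm) (hφ0 ha), add_comm]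
      · intro c hcm hc0
        rw [hθ c ψ (h0 hcm) hc0 hψ0, Complex.norm_real, Real.norm_eq_abs]
      · intro j
        fin_cases j
        · exact hφ1 ha
        · exact (hxx a).trans (hφ0 ha)
        · exact hf1
    · rw [LinearIndependent.pair_iff' ha0] at hli
      push Not at hli
      obtain ⟨r, hr⟩ := hli
      have hr' : x.1 *ᵥ (-a) = (-r) • a := by rw [mulVec_neg, ← hr, neg_smul]
      have hne : ψ + (-r) • ψ' ≠ 0 := by
        intro h
        have := LinearIndependent.pair_iff.mp hψ 1 (-r) (by rwa [one_smul])
        exact one_ne_zero this.1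
      rw [hr', tv_smul _ (hφ2 ha), tv_mul_tv_right (hφ0 ha) (by
        rw [smul_dotProduct, hφ2 ha, smul_zero]), hθ _ _ ?_ ha0 hne, Complex.norm_real,
        Real.norm_eq_abs]
      · linarith
      · rw [add_dotProduct, smul_dotProduct, hφ0 ha, hφ2 ha, smul_zero, add_zero]
  · intro j
    fin_cases j
    · change ψ ⬝ᵥ b₀ = 0
      simpa using hb₀' 0
    · change (ψ ᵥ* x.1) ⬝ᵥ b₀ = 0
      simpa [dotProduct_mulVec] using hb₀' 1
    · have := hb₀' (orderOf x - 1)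
      rw [← hinv, dotProduct_mulVec] at this
      exact this

end UnitaryDual

namespace Matrix.SpecialLinearGroup

variable {n : ℕ} {F : Type*} [Field F]

/-- The parameters `(φ, b)` of transvections, with `φ ≠ 0` and `φ b = 0`. -/
abbrev TvParam (n : ℕ) (F : Type*) [Field F] : Type _ :=
  {p : (Fin n → F) × (Fin n → F) // p.1 ≠ 0 ∧ p.1 ⬝ᵥ p.2 = 0}

/-- The product of a tuple of transvections. -/
noncomputable def tvProd {s : ℕ} (f : Fin s → TvParam n F) : SpecialLinearGroup (Fin n) F :=
  (List.ofFn fun j => tv (f j).1.2 (f j).1.1).prod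

theorem tvProd_succ {s : ℕ} (f : Fin (s + 1) → TvParam n F) :
    tvProd f = tv (f 0).1.2 (f 0).1.1 * tvProd (Fin.tail f) := by
  rw [tvProd, List.ofFn_succ, List.prod_cons]
  rfl

theorem mulVec_tvProd_tail {s : ℕ} {f : Fin (s + 1) → TvParam n F} {y : Fin n → F}
    (h : (tvProd f).1 *ᵥ y = y) :
    (tvProd (Fin.tail f)).1 *ᵥ y = y - ((f 0).1.1 ⬝ᵥ y) • (f 0).1.2 := by
  have hd := (f 0).2.2
  have h1 : tvProd (Fin.tail f) = tv (-(f 0).1.2) (f 0).1.1 * tvProd f := by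
    rw [tvProd_succ, tv_neg hd, inv_mul_cancel_left]
  rw [h1, coe_mul, ← mulVec_mulVec, h, tv_mulVec (by rw [dotProduct_neg, hd, neg_zero]), smul_neg,
    ← sub_eq_add_neg]

/-- The kernel of a row vector. -/
def rowKer (φ : Fin n → F) : Submodule F (Fin n → F) := ann fun _ : Fin 1 => φ

theorem mem_rowKer {φ v : Fin n → F} : v ∈ rowKer φ ↔ φ ⬝ᵥ v = 0 := by
  rw [rowKer, mem_ann]
  exact ⟨fun h => h 0, fun h _ => h⟩

theorem finrank_inf_rowKer {Y : Submodule F (Fin n → F)} {φ : Fin n → F}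
    (h : ∃ y ∈ Y, φ ⬝ᵥ y ≠ 0) :
    Module.finrank F (Y ⊓ rowKer φ : Submodule F (Fin n → F)) + 1 = Module.finrank F Y := by
  set f : Module.Dual F Y := (dotProductEquiv F (Fin n) φ).domRestrict Y
  have hf (y : Y) : f y = φ ⬝ᵥ y.1 := rfl
  have hf0 : f ≠ 0 := by
    obtain ⟨y, hy, hne⟩ := h
    intro h0
    exact hne ((hf ⟨y, hy⟩).symm.trans (by rw [h0, LinearMap.zero_apply]))
  have hY : Y ⊓ rowKer φ = Submodule.map Y.subtype (LinearMap.ker f) := by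
    ext v
    rw [Submodule.mem_inf, mem_rowKer, Submodule.mem_map]
    constructor
    · rintro ⟨hv, h0⟩
      exact ⟨⟨v, hv⟩, LinearMap.mem_ker.mpr ((hf _).trans h0), rfl⟩
    · rintro ⟨w, hw, rfl⟩
      exact ⟨w.2, (hf w).symm.trans (LinearMap.mem_ker.mp hw)⟩
  rw [← Module.Dual.finrank_ker_add_one_of_ne_zero hf0, hY, Submodule.finrank_map_subtype_eq]

/-- Conjugation permutes the parameters of transvections. -/
theorem exists_tvParam_equiv (g : SpecialLinearGroup (Fin n) F) :
    ∃ σ : TvParam n F ≃ TvParam n F, ∀ p, tv (σ p).1.2 (σ p).1.1 = g * tv p.1.2 p.1.1 * g⁻¹ := by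
  have key : ∀ (h : SpecialLinearGroup (Fin n) F) (p : TvParam n F),
      p.1.1 ᵥ* (h⁻¹).1 ≠ 0 ∧ (p.1.1 ᵥ* (h⁻¹).1) ⬝ᵥ (h.1 *ᵥ p.1.2) = 0 := by
    intro h p
    have hh : (h⁻¹).1 * h.1 = 1 := by
      rw [← Matrix.SpecialLinearGroup.coe_mul, inv_mul_cancel, Matrix.SpecialLinearGroup.coe_one]
    refine ⟨fun h0 => p.2.1 ?_, ?_⟩
    · rw [← vecMul_one p.1.1, ← hh, ← vecMul_vecMul, h0, zero_vecMul]
    · rw [dotProduct_mulVec, vecMul_vecMul, hh, vecMul_one, p.2.2]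
  have inv : ∀ h : SpecialLinearGroup (Fin n) F, h.1 * (h⁻¹).1 = 1 := fun h => by
    rw [← Matrix.SpecialLinearGroup.coe_mul, mul_inv_cancel, Matrix.SpecialLinearGroup.coe_one]
  let f : SpecialLinearGroup (Fin n) F → TvParam n F → TvParam n F :=
    fun h p => ⟨(p.1.1 ᵥ* (h⁻¹).1, h.1 *ᵥ p.1.2), key h p⟩
  have hf : ∀ h p, f h⁻¹ (f h p) = p := by
    intro h p
    refine Subtype.ext (Prod.ext ?_ ?_)
    · change (p.1.1 ᵥ* (h⁻¹).1) ᵥ* ((h⁻¹)⁻¹).1 = p.1.1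
      rw [vecMul_vecMul, inv, vecMul_one]
    · change (h⁻¹).1 *ᵥ (h.1 *ᵥ p.1.2) = p.1.2
      have := inv h⁻¹
      rw [inv_inv] at this
      rw [mulVec_mulVec, this, one_mulVec]
  exact ⟨⟨f g, f g⁻¹, hf g, fun p => by simpa using hf g⁻¹ p⟩, fun p => (conj_tv g _ _).symm⟩

variable [Fintype F]

theorem card_rowKer {φ : Fin n → F} (hφ : φ ≠ 0) :
    Nat.card (rowKer φ) = Fintype.card F ^ (n - 1) := by
  rw [Module.natCard_eq_pow_finrank (K := F), Nat.card_eq_fintype_card]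
  obtain ⟨y, hy⟩ := exists_dotProduct_eq_one hφ
  have h := finrank_inf_rowKer (Y := ⊤) (φ := φ)
    ⟨y, trivial, by rw [dotProduct_comm, hy]; exact one_ne_zero⟩
  rw [top_inf_eq, finrank_top, Module.finrank_fin_fun] at h
  congr 1
  omega

open Classical in
theorem card_filter_forall_dotProduct_eq_zero (Y : Submodule F (Fin n → F)) :
    (Finset.univ.filter fun φ : Fin n → F => ∀ y ∈ Y, φ ⬝ᵥ y = 0).card =
      Fintype.card F ^ (n - Module.finrank F Y) := by
  have h1 : Nat.card Y.dualAnnihilator = Fintype.card F ^ (n - Module.finrank F Y) := by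
    rw [Module.natCard_eq_pow_finrank (K := F), Nat.card_eq_fintype_card]
    have := Subspace.finrank_add_finrank_dualAnnihilator_eq Y
    rw [Module.finrank_fin_fun] at this
    congr 1
    omega
  rw [← h1, ← Fintype.card_subtype, ← Nat.card_eq_fintype_card]
  refine Nat.card_congr ((dotProductEquiv F (Fin n)).toEquiv.subtypeEquiv fun φ => ?_)
  rw [Submodule.mem_dualAnnihilator]
  rfl

open Classical in
/-- The tuples of transvections whose product fixes a subspace pointwise. -/
noncomputable def fixing (s : ℕ) (Y : Submodule F (Fin n → F)) : Finset (Fin s → TvParam n F) :=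
  Finset.univ.filter fun f => ∀ y ∈ Y, (tvProd f).1 *ᵥ y = y

theorem mem_fixing {s : ℕ} {Y : Submodule F (Fin n → F)} {f : Fin s → TvParam n F} :
    f ∈ fixing s Y ↔ ∀ y ∈ Y, (tvProd f).1 *ᵥ y = y := by
  simp [fixing]

open Classical in
theorem card_param_filter_le (Y : Submodule F (Fin n → F)) :
    (Finset.univ.filter fun p : TvParam n F => ∀ y ∈ Y, p.1.1 ⬝ᵥ y = 0).card ≤
      Fintype.card F ^ (n - 1) * Fintype.card F ^ (n - Module.finrank F Y) := by
  refine (Finset.card_le_mul_card_image (f := fun p : TvParam n F => p.1.1) _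
    (Fintype.card F ^ (n - 1)) ?_).trans (Nat.mul_le_mul_left _ ?_)
  · intro φ hφ
    obtain ⟨p, -, rfl⟩ := Finset.mem_image.mp hφ
    rw [← card_rowKer p.2.1, Nat.card_eq_fintype_card, ← Finset.card_univ]
    refine Finset.card_le_card_of_injOn
      (fun p' => if h : p'.1.2 ∈ rowKer p.1.1 then ⟨p'.1.2, h⟩ else 0) (by simp [Set.MapsTo]) ?_
    have hmem : ∀ p' ∈ {a ∈ Finset.univ.filter (fun p : TvParam n F => ∀ y ∈ Y, p.1.1 ⬝ᵥ y = 0) |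
        a.1.1 = p.1.1}, p'.1.1 = p.1.1 ∧ p'.1.2 ∈ rowKer p.1.1 := by
      intro p' hp'
      have h1 := (Finset.mem_filter.mp hp').2
      exact ⟨h1, mem_rowKer.mpr (h1 ▸ p'.2.2)⟩
    intro p₁ hp₁ p₂ hp₂ h
    obtain ⟨h1, h1'⟩ := hmem p₁ hp₁
    obtain ⟨h2, h2'⟩ := hmem p₂ hp₂
    simp only [h1', h2', dif_pos, Subtype.mk.injEq] at h
    exact Subtype.ext (Prod.ext (h1.trans h2.symm) h)
  · rw [← card_filter_forall_dotProduct_eq_zero]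
    refine Finset.card_le_card fun φ hφ => ?_
    obtain ⟨p, hp, rfl⟩ := Finset.mem_image.mp hφ
    simpa using hp

open Classical in
theorem card_fixing_succ_le (s : ℕ) (Y : Submodule F (Fin n → F)) :
    (fixing (s + 1) Y).card ≤
      Fintype.card F ^ (n - 1) * Fintype.card F ^ (n - Module.finrank F Y) * (fixing s Y).card +
      ∑ φ ∈ Finset.univ.filter (fun φ : Fin n → F => ∃ y ∈ Y, φ ⬝ᵥ y ≠ 0),
        (fixing s (Y ⊓ rowKer φ)).card := by
  rw [← Finset.card_filter_add_card_filter_not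
    (fun f : Fin (s + 1) → TvParam n F => ∀ y ∈ Y, (f 0).1.1 ⬝ᵥ y = 0)]
  refine Nat.add_le_add ?_ ?_
  · refine le_trans ?_ (Nat.mul_le_mul_right _ (card_param_filter_le Y))
    rw [← Finset.card_product]
    refine Finset.card_le_card_of_injOn (fun f => (f 0, Fin.tail f)) ?_ ?_
    · intro f hf
      obtain ⟨h1, h2⟩ := Finset.mem_filter.mp hf
      refine Finset.mem_coe.mpr (Finset.mem_product.mpr ⟨by simpa using h2, ?_⟩)
      refine mem_fixing.mpr fun y hy => ?_
      rw [mulVec_tvProd_tail (mem_fixing.mp h1 y hy), h2 y hy, zero_smul, sub_zero]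
    · intro f _ f' _ h
      have h1 : f 0 = f' 0 := congrArg Prod.fst h
      have h2 : Fin.tail f = Fin.tail f' := congrArg Prod.snd h
      rw [← Fin.cons_self_tail f, ← Fin.cons_self_tail f', h1, h2]
  · rw [← Finset.card_sigma]
    refine Finset.card_le_card_of_injOn (fun f => ⟨(f 0).1.1, Fin.tail f⟩) ?_ ?_
    · intro f hf
      obtain ⟨h1, h2⟩ := Finset.mem_filter.mp hf
      refine Finset.mem_coe.mpr (Finset.mem_sigma.mpr ⟨by simpa using h2, ?_⟩)
      refine mem_fixing.mpr fun y hy => ?_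
      rw [mulVec_tvProd_tail (mem_fixing.mp h1 y hy.1), mem_rowKer.mp hy.2, zero_smul, sub_zero]
    · intro f hf f' hf' h
      obtain ⟨h1, h2⟩ := Finset.mem_filter.mp hf
      obtain ⟨h1', -⟩ := Finset.mem_filter.mp hf'
      rw [Sigma.mk.injEq] at h
      obtain ⟨hφ, ht⟩ := h
      have ht := eq_of_heq ht
      push Not at h2
      obtain ⟨y, hy, hne⟩ := h2
      have e1 := mulVec_tvProd_tail (mem_fixing.mp h1 y hy)
      rw [ht, mulVec_tvProd_tail (mem_fixing.mp h1' y hy), ← hφ, sub_right_inj] at e1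
      have hb := smul_right_injective _ hne e1
      rw [← Fin.cons_self_tail f, ← Fin.cons_self_tail f', ht]
      congr 1
      exact Subtype.ext (Prod.ext hφ hb.symm)

/-- The number of tuples of transvections whose product fixes a subspace pointwise. -/
theorem card_fixing_le (hn : 1 ≤ n) (s : ℕ) : ∀ Y : Submodule F (Fin n → F),
    ∃ k : ℕ, k ≤ Module.finrank F Y ∧ ((fixing s Y).card : ℝ) ≤ 2 ^ s * (Fintype.card F : ℝ) ^
      ((2 * n - 1) * s - (n - 1) * Module.finrank F Y +
        k * (n - 1 - (s - Module.finrank F Y) - k) : ℤ) := by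
  classical
  have hq1 : (1 : ℝ) ≤ Fintype.card F := by exact_mod_cast Fintype.card_pos
  have hq0 : (0 : ℝ) < Fintype.card F := by linarith
  induction s with
  | zero =>
    intro Y
    refine ⟨Module.finrank F Y, le_rfl, ?_⟩
    have h1 : (fixing 0 Y).card ≤ 1 :=
      (Finset.card_le_univ _).trans (by simp)
    have h2 : ((2 * n - 1) * (0 : ℕ) - (n - 1) * Module.finrank F Y + Module.finrank F Y *
        (n - 1 - ((0 : ℕ) - Module.finrank F Y) - Module.finrank F Y) : ℤ) = 0 := by
      push_cast
      ring
    rw [h2]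
    simpa using h1
  | succ s ih =>
    intro Y
    set q : ℝ := (Fintype.card F : ℝ) with hq
    set y := Module.finrank F Y with hy
    have hyn : y ≤ n := by
      have := Submodule.finrank_le Y
      rwa [Module.finrank_fin_fun] at this
    set e : ℕ → ℤ := fun k => (2 * n - 1) * (s + 1 : ℕ) - (n - 1) * y +
        k * (n - 1 - ((s + 1 : ℕ) - y) - k) with he
    obtain ⟨k₁, hk₁, h₁⟩ := ih Y
    have hA : ((Fintype.card F ^ (n - 1) * Fintype.card F ^ (n - y) * (fixing s Y).card : ℕ) : ℝ) ≤
        2 ^ s * q ^ e k₁ := by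
      push_cast
      rw [← hq, ← pow_add, ← zpow_natCast]
      refine (mul_le_mul_of_nonneg_left h₁ (by positivity)).trans ?_
      rw [mul_left_comm, ← zpow_add₀ hq0.ne']
      refine mul_le_mul_of_nonneg_left (zpow_le_zpow_right₀ hq1 ?_) (by positivity)
      simp only [he]
      push_cast [Nat.cast_sub hn, Nat.cast_sub hyn]
      have : (k₁ : ℤ) ≤ y := by exact_mod_cast hk₁
      nlinarith
    suffices hB : ∃ k₂ ≤ y, ((∑ φ ∈ Finset.univ.filter (fun φ : Fin n → F => ∃ y ∈ Y, φ ⬝ᵥ y ≠ 0),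
        (fixing s (Y ⊓ rowKer φ)).card : ℕ) : ℝ) ≤ 2 ^ s * q ^ e k₂ by
      obtain ⟨k₂, hk₂, h₂⟩ := hB
      have h3 : ((fixing (s + 1) Y).card : ℝ) ≤ 2 ^ s * q ^ e k₁ + 2 ^ s * q ^ e k₂ :=
        (Nat.cast_le.mpr (card_fixing_succ_le s Y)).trans
          (by rw [Nat.cast_add]; exact add_le_add hA h₂)
      rcases le_total (q ^ e k₁) (q ^ e k₂) with h | h
      · refine ⟨k₂, hk₂, h3.trans ?_⟩
        rw [pow_succ]
        change _ ≤ 2 ^ s * 2 * q ^ e k₂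
        nlinarith [pow_pos (two_pos (α := ℝ)) s]
      · refine ⟨k₁, hk₁, h3.trans ?_⟩
        rw [pow_succ]
        change _ ≤ 2 ^ s * 2 * q ^ e k₁
        nlinarith [pow_pos (two_pos (α := ℝ)) s]
    set A := Finset.univ.filter (fun φ : Fin n → F => ∃ y ∈ Y, φ ⬝ᵥ y ≠ 0) with hA
    rcases A.eq_empty_or_nonempty with h0 | hne
    · refine ⟨0, Nat.zero_le _, ?_⟩
      rw [h0, Finset.sum_empty, Nat.cast_zero]
      positivity
    obtain ⟨φ, hφ, hmax⟩ := Finset.exists_max_image A (fun φ => (fixing s (Y ⊓ rowKer φ)).card) hne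
    have hrank := finrank_inf_rowKer (Finset.mem_filter.mp hφ).2
    rw [← hy] at hrank
    obtain ⟨k, hk, h2⟩ := ih (Y ⊓ rowKer φ)
    refine ⟨k, by omega, ?_⟩
    have hcard : A.card ≤ Fintype.card F ^ n :=
      (Finset.card_le_univ _).trans (by simp)
    have h3 : ∑ φ ∈ A, (fixing s (Y ⊓ rowKer φ)).card ≤
        Fintype.card F ^ n * (fixing s (Y ⊓ rowKer φ)).card :=
      (Finset.sum_le_card_nsmul A _ _ hmax).trans
        (by rw [smul_eq_mul]; exact Nat.mul_le_mul_right _ hcard)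
    refine (Nat.cast_le.mpr h3).trans ?_
    push_cast
    rw [← hq, ← zpow_natCast]
    refine (mul_le_mul_of_nonneg_left h2 (by positivity)).trans (le_of_eq ?_)
    rw [mul_left_comm, ← zpow_add₀ hq0.ne']
    congr 2
    simp only [he]
    rw [← hrank]
    push_cast
    ring

variable [DecidableEq F]

theorem card_tvParam : Fintype.card (TvParam n F) =
    (Fintype.card F ^ n - 1) * Fintype.card F ^ (n - 1) := by
  classical
  have e : TvParam n F ≃ Σ φ : {φ : Fin n → F // φ ≠ 0}, rowKer φ.1 :=
    { toFun := fun p => ⟨⟨p.1.1, p.2.1⟩, ⟨p.1.2, mem_rowKer.mpr p.2.2⟩⟩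
      invFun := fun s => ⟨(s.1.1, s.2.1), s.1.2, mem_rowKer.mp s.2.2⟩
      left_inv := fun _ => rfl
      right_inv := fun _ => rfl }
  rw [← Nat.card_eq_fintype_card, Nat.card_congr e, Nat.card_sigma,
    Finset.sum_congr rfl fun φ _ => card_rowKer φ.2, Finset.sum_const, smul_eq_mul,
    Finset.card_univ, Fintype.card_subtype_compl, Fintype.card_subtype_eq]
  simp

theorem card_filter_snd_eq_zero :
    (Finset.univ.filter fun p : TvParam n F => p.1.2 = 0).card = Fintype.card F ^ n - 1 := by
  classical
  have e : {p : TvParam n F // p.1.2 = 0} ≃ {φ : Fin n → F // φ ≠ 0} :=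
    { toFun := fun p => ⟨p.1.1.1, p.1.2.1⟩
      invFun := fun φ => ⟨⟨(φ.1, 0), φ.2, dotProduct_zero _⟩, rfl⟩
      left_inv := fun p => Subtype.ext (Subtype.ext (Prod.ext rfl p.2.symm))
      right_inv := fun _ => rfl }
  rw [← Fintype.card_subtype, Fintype.card_congr e, Fintype.card_subtype_compl,
    Fintype.card_subtype_eq]
  simp

theorem card_tvProd_eq_one_le (hn : 1 ≤ n) :
    (Nat.card {f : Fin (2 * n) → TvParam n F //
      (List.ofFn fun j => tv (f j).1.2 (f j).1.1).prod = 1} : ℝ) ≤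
      4 ^ n * (Fintype.card F : ℝ) ^ (3 * n ^ 2 - n) := by
  classical
  have hq1 : (1 : ℝ) ≤ Fintype.card F := by exact_mod_cast Fintype.card_pos
  obtain ⟨k, -, h⟩ := card_fixing_le hn (2 * n) (⊤ : Submodule F (Fin n → F))
  have h1 : Nat.card {f : Fin (2 * n) → TvParam n F //
      (List.ofFn fun j => tv (f j).1.2 (f j).1.1).prod = 1} ≤
      (fixing (2 * n) (⊤ : Submodule F (Fin n → F))).card := by
    rw [Nat.card_eq_fintype_card, Fintype.card_subtype]
    refine Finset.card_le_card fun f hf => mem_fixing.mpr fun y _ => ?_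
    have : tvProd f = 1 := (Finset.mem_filter.mp hf).2
    rw [this, Matrix.SpecialLinearGroup.coe_one, one_mulVec]
  refine (Nat.cast_le.mpr h1).trans (h.trans ?_)
  rw [pow_mul, show (2 : ℝ) ^ 2 = 4 by norm_num, ← zpow_natCast (Fintype.card F : ℝ)]
  refine mul_le_mul_of_nonneg_left (zpow_le_zpow_right₀ hq1 ?_) (by positivity)
  have hle : n ≤ 3 * n ^ 2 := by nlinarith
  rw [finrank_top, Module.finrank_fin_fun]
  push_cast [Nat.cast_sub hle]
  nlinarith [sq_nonneg (k : ℤ)]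

theorem card_le_two_mul (hn : 1 ≤ n) :
    (Fintype.card (SpecialLinearGroup (Fin n) F) : ℝ) ≤
      2 * (Fintype.card F : ℝ) ^ (n ^ 2 - 1) := by
  classical
  set q := Fintype.card F with hq
  have hq2 : 2 ≤ q := Fintype.one_lt_card
  let i₀ : Fin n := ⟨0, hn⟩
  let D : Fˣ → Matrix (Fin n) (Fin n) F := fun u => diagonal (Function.update 1 i₀ (u : F))
  have hD : ∀ u, (D u).det = u := fun u => by
    simp only [D, det_diagonal]
    rw [Finset.prod_update_of_mem (Finset.mem_univ _)]
    simp
  have hinj : Function.Injective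
      fun p : Fˣ × SpecialLinearGroup (Fin n) F => D p.1 * p.2.1 := by
    rintro ⟨u, g⟩ ⟨v, h⟩ huv
    have e1 := congrArg Matrix.det huv
    simp only [det_mul, hD, SpecialLinearGroup.det_coe, mul_one] at e1
    obtain rfl : u = v := Units.ext e1
    have hu : IsUnit (D u) := (Matrix.isUnit_iff_isUnit_det _).mpr (by rw [hD]; exact u.isUnit)
    exact Prod.ext rfl (Subtype.ext (hu.mul_left_cancel huv))
  have hM : Fintype.card (Matrix (Fin n) (Fin n) F) = q ^ (n * n) := by
    rw [← Nat.card_eq_fintype_card]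
    change Nat.card (Fin n → Fin n → F) = _
    rw [Nat.card_eq_fintype_card]
    simp [← pow_mul, hq]
  have hc := Fintype.card_le_of_injective _ hinj
  rw [Fintype.card_prod, Fintype.card_units, hM, ← hq] at hc
  have h3 : q ^ (n * n) = q * q ^ (n ^ 2 - 1) := by
    rw [← pow_succ']
    congr 1
    have : 1 ≤ n ^ 2 := Nat.one_le_pow _ _ hn
    rw [Nat.sub_add_cancel this, sq]
  rw [h3] at hc
  set S := Fintype.card (SpecialLinearGroup (Fin n) F)
  have : q * S ≤ q * (2 * q ^ (n ^ 2 - 1)) := by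
    have h4 : q ≤ 2 * (q - 1) := by omega
    calc q * S ≤ 2 * (q - 1) * S := Nat.mul_le_mul_right _ h4
      _ = 2 * ((q - 1) * S) := by ring
      _ ≤ 2 * (q * q ^ (n ^ 2 - 1)) := Nat.mul_le_mul_left _ hc
      _ = _ := by ring
  exact_mod_cast Nat.le_of_mul_le_mul_left this (by omega)

end Matrix.SpecialLinearGroup

namespace UnitaryDual

open Matrix SpecialLinearGroup

variable {n : ℕ} {F : Type*} [Field F] [Fintype F] [DecidableEq F]
  (D : UnitaryDual (SpecialLinearGroup (Fin n) F))

/-- The mean of a normalized character over the transvection parameters. -/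
theorem exists_mean_w_tv (hn : 3 ≤ n) (i : Fin D.r) {θ : ℝ}
    (hθ : ∀ b φ : Fin n → F, φ ⬝ᵥ b = 0 → b ≠ 0 → φ ≠ 0 → D.w i (tv b φ) = θ) :
    ∃ α : ℝ, ∑ p : TvParam n F, D.w i (tv p.1.2 p.1.1) = Fintype.card (TvParam n F) * α ∧
      |θ| ≤ 2 * |α| + 2 / (Fintype.card F : ℝ) ^ (n - 1) := by
  have hq : (2 : ℝ) ≤ Fintype.card F := by
    exact_mod_cast (Fintype.one_lt_card : 1 < Fintype.card F)
  set q : ℝ := (Fintype.card F : ℝ)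
  set ε : ℝ := 1 / q ^ (n - 1) with hε
  have hε0 : 0 < ε := by positivity
  have hε4 : ε ≤ 1 / 4 := by
    refine one_div_le_one_div_of_le (by norm_num) ?_
    calc (4 : ℝ) = 2 ^ 2 := by norm_num
      _ ≤ q ^ 2 := by gcongr
      _ ≤ q ^ (n - 1) := pow_le_pow_right₀ (by linarith) (by omega)
  have hZ : ((Finset.univ.filter fun p : TvParam n F => p.1.2 = 0).card : ℝ) =
      Fintype.card (TvParam n F) * ε := by
    rw [card_filter_snd_eq_zero, card_tvParam]
    push_cast
    rw [hε]
    field_simp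
    rfl
  have hsplit := Finset.card_filter_add_card_filter_not (s := (Finset.univ : Finset (TvParam n F)))
    (fun p : TvParam n F => p.1.2 = 0)
  rw [Finset.card_univ] at hsplit
  have hsplit' : ((Finset.univ.filter fun p : TvParam n F => ¬ p.1.2 = 0).card : ℝ) =
      Fintype.card (TvParam n F) * (1 - ε) := by
    rw [mul_sub, mul_one, ← hZ, ← hsplit]
    push_cast
    ring
  refine ⟨ε + (1 - ε) * θ, ?_, ?_⟩
  · rw [← Finset.sum_filter_add_sum_filter_not Finset.univ (fun p : TvParam n F => p.1.2 = 0),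
      Finset.sum_congr rfl (g := fun _ => (1 : ℂ)) fun p hp => by
        rw [(Finset.mem_filter.mp hp).2, tv_zero, D.w_one],
      Finset.sum_congr rfl (g := fun _ => (θ : ℂ)) fun p hp =>
        hθ _ _ p.2.2 (Finset.mem_filter.mp hp).2 p.2.1]
    rw [Finset.sum_const, Finset.sum_const, nsmul_eq_mul, nsmul_eq_mul]
    have e1 := congrArg (Complex.ofReal) hZ
    have e2 := congrArg (Complex.ofReal) hsplit'
    push_cast at e1 e2 ⊢
    rw [e1, e2]
    ring
  · have h1 : (1 - ε) * |θ| ≤ |ε + (1 - ε) * θ| + ε := by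
      have := abs_sub (ε + (1 - ε) * θ) ε
      rw [add_sub_cancel_left, abs_mul, abs_of_pos hε0, abs_of_nonneg (by linarith)] at this
      exact this
    have h2 : 2 / q ^ (n - 1) = 2 * ε := by rw [hε]; ring
    rw [h2]
    nlinarith [abs_nonneg θ]

theorem sum_sq_mul_mean_pow_le (hn : 2 ≤ n) {α : Fin D.r → ℝ}
    (hα : ∀ i, ∑ p : TvParam n F, D.w i (tv p.1.2 p.1.1) = Fintype.card (TvParam n F) * α i) :
    ∑ i, (D.d i : ℝ) ^ 2 * α i ^ (2 * n) ≤ 2 * 16 ^ n * (Fintype.card F : ℝ) ^ (n - 1) := by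
  have hq : (2 : ℝ) ≤ Fintype.card F := by
    exact_mod_cast (Fintype.one_lt_card : 1 < Fintype.card F)
  have h := D.sum_sq_mul_pow_eq_card (fun p : TvParam n F => tv p.1.2 p.1.1)
    exists_tvParam_equiv (2 * n)
  set c := Nat.card {f : Fin (2 * n) → TvParam n F //
      (List.ofFn fun j => tv (f j).1.2 (f j).1.1).prod = 1} with hc
  have hcle : (c : ℝ) ≤ _ := card_tvProd_eq_one_le (n := n) (F := F) (by omega)
  have hG := card_le_two_mul (n := n) (F := F) (by omega)
  have hN : (Fintype.card F : ℝ) ^ (2 * n - 1) / 2 ≤ Fintype.card (TvParam n F) := by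
    have h1 : 1 ≤ Fintype.card F ^ n := Nat.one_le_pow _ _ Fintype.card_pos
    rw [card_tvParam]
    push_cast [Nat.cast_sub h1]
    have h2 : (2 : ℝ) ≤ (Fintype.card F : ℝ) ^ n := hq.trans (le_self_pow₀ (by linarith) (by omega))
    rw [show 2 * n - 1 = n + (n - 1) by omega, pow_add]
    nlinarith [pow_pos (show (0 : ℝ) < Fintype.card F by linarith) (n - 1)]
  set q : ℝ := (Fintype.card F : ℝ)
  set N : ℝ := (Fintype.card (TvParam n F) : ℝ) with hNdef
  have hN0 : 0 < N := lt_of_lt_of_le (by positivity) hN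
  have hreal : N ^ (2 * n) * ∑ i, (D.d i : ℝ) ^ 2 * α i ^ (2 * n) =
      Fintype.card (SpecialLinearGroup (Fin n) F) * c := by
    have h3 : ((N ^ (2 * n) * ∑ i, (D.d i : ℝ) ^ 2 * α i ^ (2 * n) : ℝ) : ℂ) =
        ((Fintype.card (SpecialLinearGroup (Fin n) F) * c : ℝ) : ℂ) := by
      push_cast
      rw [← h, Finset.mul_sum]
      refine Finset.sum_congr rfl fun i _ => ?_
      rw [hα, hNdef, mul_pow]
      push_cast
      ring
    exact_mod_cast h3
  have hNpow : q ^ ((2 * n - 1) * (2 * n)) / 4 ^ n ≤ N ^ (2 * n) := by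
    calc q ^ ((2 * n - 1) * (2 * n)) / 4 ^ n = (q ^ (2 * n - 1) / 2) ^ (2 * n) := by
          rw [div_pow, ← pow_mul, pow_mul 2, show (2 : ℝ) ^ 2 = 4 by norm_num]
      _ ≤ N ^ (2 * n) := by gcongr
  set S := ∑ i, (D.d i : ℝ) ^ 2 * α i ^ (2 * n) with hS
  have hS0 : 0 ≤ S := Finset.sum_nonneg fun i _ => by
    rw [pow_mul]
    positivity
  have h5 : q ^ ((2 * n - 1) * (2 * n)) / 4 ^ n * S ≤
      2 * q ^ (n ^ 2 - 1) * (4 ^ n * q ^ (3 * n ^ 2 - n)) :=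
    (mul_le_mul_of_nonneg_right hNpow hS0).trans (hreal.le.trans (by gcongr))
  have h6 : q ^ (n ^ 2 - 1) * q ^ (3 * n ^ 2 - n) = q ^ ((2 * n - 1) * (2 * n)) * q ^ (n - 1) := by
    rw [← pow_add, ← pow_add]
    congr 1
    obtain ⟨m, rfl⟩ := Nat.exists_eq_add_of_le hn
    have e1 : (2 + m) ^ 2 - 1 = m ^ 2 + 4 * m + 3 := by
      rw [show (2 + m) ^ 2 = m ^ 2 + 4 * m + 3 + 1 by ring, Nat.add_sub_cancel]
    have e2 : 3 * (2 + m) ^ 2 - (2 + m) = 3 * m ^ 2 + 11 * m + 10 := by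
      rw [show 3 * (2 + m) ^ 2 = 3 * m ^ 2 + 11 * m + 10 + (2 + m) by ring, Nat.add_sub_cancel]
    rw [e1, e2, show 2 * (2 + m) - 1 = 2 * m + 3 by omega, show 2 + m - 1 = m + 1 by omega]
    ring
  have hpos : 0 < q ^ ((2 * n - 1) * (2 * n)) / 4 ^ n := by positivity
  refine le_of_mul_le_mul_left (h5.trans (le_of_eq ?_)) hpos
  have h16 : (16 : ℝ) ^ n = 4 ^ n * 4 ^ n := by rw [← mul_pow]; norm_num
  calc 2 * q ^ (n ^ 2 - 1) * (4 ^ n * q ^ (3 * n ^ 2 - n))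
      = 2 * 4 ^ n * (q ^ (n ^ 2 - 1) * q ^ (3 * n ^ 2 - n)) := by ring
    _ = 2 * 4 ^ n * (q ^ ((2 * n - 1) * (2 * n)) * q ^ (n - 1)) := by rw [h6]
    _ = _ := by
      rw [h16]
      field_simp

theorem mean_pow_le (hn : 2 ≤ n) {α : Fin D.r → ℝ}
    (hα : ∀ i, ∑ p : TvParam n F, D.w i (tv p.1.2 p.1.1) = Fintype.card (TvParam n F) * α i)
    {i : Fin D.r} (hi : i ∈ D.nontriv) :
    α i ^ (2 * n) ≤ 32 * 16 ^ n / (Fintype.card F : ℝ) ^ (n - 1) := by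
  have hq : (0 : ℝ) < Fintype.card F := by exact_mod_cast Fintype.card_pos
  have hnn : ∀ j, 0 ≤ α j ^ (2 * n) := fun j => by
    rw [pow_mul]
    positivity
  have h1 := (Finset.single_le_sum (f := fun j => (D.d j : ℝ) ^ 2 * α j ^ (2 * n))
    (fun j _ => mul_nonneg (sq_nonneg _) (hnn j)) (Finset.mem_univ i)).trans
    (D.sum_sq_mul_mean_pow_le hn hα)
  have h2 := D.card_pow_le_d hn hi
  set P := (Fintype.card F : ℝ) ^ (n - 1)
  have hP : 0 < P := by positivity
  rw [le_div_iff₀ hP]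
  have h3 : P ^ 2 * α i ^ (2 * n) ≤ 16 * (2 * 16 ^ n * P) :=
    calc P ^ 2 * α i ^ (2 * n) ≤ (4 * D.d i) ^ 2 * α i ^ (2 * n) :=
          mul_le_mul_of_nonneg_right (by gcongr) (hnn i)
      _ = 16 * ((D.d i : ℝ) ^ 2 * α i ^ (2 * n)) := by ring
      _ ≤ _ := by gcongr
  refine le_of_mul_le_mul_left (?_ : P * _ ≤ P * _) hP
  linarith

theorem sum_nontriv_le_of_not_cyclic (hn : 3 ≤ n) {x : SpecialLinearGroup (Fin n) F}
    (hx : x ∉ Subgroup.center (SpecialLinearGroup (Fin n) F))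
    (hc : ∀ ψ : Fin n → F, ∃ b, b ≠ 0 ∧ ∀ k : ℕ, ψ ⬝ᵥ ((x ^ k).1 *ᵥ b) = 0)
    {t : ℕ} (ht : 2 * n + 3 ≤ t) :
    ∑ i ∈ D.nontriv, (D.d i : ℝ) ^ 2 * (‖D.w i x‖ ^ t) ^ 2 ≤
      8 ^ (4 * n + 6) * (64 * 256 ^ n * (32 * 16 ^ n) ^ 3 + 2) / Fintype.card F := by
  have hq : (2 : ℝ) ≤ Fintype.card F := by
    exact_mod_cast (Fintype.one_lt_card : 1 < Fintype.card F)
  choose θ _ hθ using D.exists_w_tv_eq hn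
  choose α hα hθα using fun i => D.exists_mean_w_tv hn i (hθ i)
  have hsum := D.sum_sq_mul_mean_pow_le (by omega) hα
  have hmax := fun i hi => D.mean_pow_le (by omega) hα (i := i) hi
  have hw := fun i => D.norm_w_le_of_not_cyclic hx hc (hθ i)
  have hG := card_le_two_mul (n := n) (F := F) (by omega)
  rw [← D.sum_sq_real] at hG
  set q : ℝ := (Fintype.card F : ℝ)
  set m := max 1 (n - 3) with hm
  set ε : ℝ := 1 / q ^ m with hε
  set C : ℝ := 32 * 16 ^ n with hC
  have hC1 : 1 ≤ C := by
    have : (1 : ℝ) ≤ 16 ^ n := one_le_pow₀ (by norm_num)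
    linarith
  have hε0 : 0 < ε := by positivity
  have hnn : ∀ j, 0 ≤ α j ^ (2 * n) := fun j => by
    rw [pow_mul]
    positivity
  have hw' : ∀ i, ‖D.w i x‖ ≤ 4 * (|α i| + ε) := by
    intro i
    have h1 : 2 / q ^ (n - 1) ≤ 2 * ε := by
      rw [hε, mul_one_div]
      have : q ^ m ≤ q ^ (n - 1) := pow_le_pow_right₀ (by linarith) (by omega)
      gcongr
    have h2 : 2 / q ^ m = 2 * ε := by rw [hε, mul_one_div]
    linarith [hw i, hθα i, abs_nonneg (α i)]
  have hterm : ∀ i, (‖D.w i x‖ ^ t) ^ 2 ≤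
      8 ^ (4 * n + 6) * (|α i| ^ (4 * n + 6) + ε ^ (4 * n + 6)) := by
    intro i
    calc (‖D.w i x‖ ^ t) ^ 2 = ‖D.w i x‖ ^ (t * 2) := (pow_mul _ _ _).symm
      _ ≤ ‖D.w i x‖ ^ (4 * n + 6) :=
          pow_le_pow_of_le_one (norm_nonneg _) (D.norm_w_le_one i x) (by omega)
      _ ≤ (4 * (|α i| + ε)) ^ (4 * n + 6) := by gcongr; exact hw' i
      _ = 4 ^ (4 * n + 6) * (|α i| + ε) ^ (4 * n + 6) := mul_pow _ _ _
      _ ≤ 4 ^ (4 * n + 6) *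
          (2 ^ (4 * n + 6 - 1) * (|α i| ^ (4 * n + 6) + ε ^ (4 * n + 6))) := by
          gcongr
          exact add_pow_le (abs_nonneg _) hε0.le _
      _ ≤ 4 ^ (4 * n + 6) *
          (2 ^ (4 * n + 6) * (|α i| ^ (4 * n + 6) + ε ^ (4 * n + 6))) := by
          gcongr
          · norm_num
          · omega
      _ = _ := by
          rw [← mul_assoc, ← mul_pow]
          norm_num
  have hα6 : ∀ i ∈ D.nontriv, |α i| ^ 6 ≤ C ^ 3 / q := by
    intro i hi
    refine le_of_pow_le_pow_left₀ (n := n) (by omega) (by positivity) ?_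
    calc (|α i| ^ 6) ^ n = (α i ^ (2 * n)) ^ 3 := by
          rw [pow_mul (α i), ← sq_abs, ← pow_mul, ← pow_mul, ← pow_mul]
          ring_nf
      _ ≤ (C / q ^ (n - 1)) ^ 3 := by
          gcongr
          exacts [hnn i, hmax i hi]
      _ = C ^ 3 / q ^ ((n - 1) * 3) := by rw [div_pow, ← pow_mul]
      _ ≤ (C ^ 3) ^ n / q ^ n := by
          gcongr ?_ / ?_
          · exact le_self_pow₀ (one_le_pow₀ hC1) (by omega)
          · exact pow_le_pow_right₀ (by linarith) (by omega)
      _ = (C ^ 3 / q) ^ n := (div_pow _ _ _).symm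
  have hfirst : ∑ i ∈ D.nontriv, (D.d i : ℝ) ^ 2 * |α i| ^ (4 * n + 6) ≤
      64 * 256 ^ n * C ^ 3 / q := by
    calc ∑ i ∈ D.nontriv, (D.d i : ℝ) ^ 2 * |α i| ^ (4 * n + 6)
        ≤ ∑ i ∈ D.nontriv, ((D.d i : ℝ) ^ 2 * α i ^ (2 * n)) *
            (C / q ^ (n - 1) * (C ^ 3 / q)) := by
          refine Finset.sum_le_sum fun i hi => ?_
          have e : |α i| ^ (4 * n + 6) = α i ^ (2 * n) * (α i ^ (2 * n) * |α i| ^ 6) := by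
            rw [pow_mul (α i), ← sq_abs, ← pow_mul, ← pow_add, ← pow_add]
            congr 1
            omega
          rw [e, ← mul_assoc]
          refine mul_le_mul_of_nonneg_left ?_ (mul_nonneg (sq_nonneg _) (hnn i))
          exact mul_le_mul (hmax i hi) (hα6 i hi) (by positivity) (by positivity)
      _ ≤ (2 * 16 ^ n * q ^ (n - 1)) * (C / q ^ (n - 1) * (C ^ 3 / q)) := by
          rw [← Finset.sum_mul]
          refine mul_le_mul_of_nonneg_right (le_trans ?_ hsum) (by positivity)
          exact Finset.sum_le_sum_of_subset_of_nonneg (Finset.subset_univ _)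
            fun i _ _ => mul_nonneg (sq_nonneg _) (hnn i)
      _ = 64 * 256 ^ n * C ^ 3 / q := by
          have h256 : (256 : ℝ) ^ n = 16 ^ n * 16 ^ n := by rw [← mul_pow]; norm_num
          rw [h256]
          field_simp
          rw [hC]
          ring
  have hsecond : ∑ i ∈ D.nontriv, (D.d i : ℝ) ^ 2 * ε ^ (4 * n + 6) ≤ 2 / q := by
    have hle : n ^ 2 - 1 + 1 ≤ m * (4 * n + 6) := by
      have h1 : 1 ≤ n ^ 2 := Nat.one_le_pow _ _ (by omega)
      rw [Nat.sub_add_cancel h1]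
      rcases Nat.lt_or_ge n 5 with h5 | h5
      · have : 1 ≤ m := le_max_left _ _
        nlinarith
      · have : n - 3 ≤ m := le_max_right _ _
        obtain ⟨k, rfl⟩ := Nat.exists_eq_add_of_le h5
        have : k + 2 ≤ m := by omega
        nlinarith
    calc ∑ i ∈ D.nontriv, (D.d i : ℝ) ^ 2 * ε ^ (4 * n + 6)
        ≤ (2 * q ^ (n ^ 2 - 1)) * ε ^ (4 * n + 6) := by
          rw [← Finset.sum_mul]
          refine mul_le_mul_of_nonneg_right (le_trans ?_ hG) (by positivity)
          exact Finset.sum_le_sum_of_subset_of_nonneg (Finset.subset_univ _)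
            fun i _ _ => sq_nonneg _
      _ = 2 * q ^ (n ^ 2 - 1) / q ^ (m * (4 * n + 6)) := by
          rw [hε, div_pow, one_pow, ← pow_mul, mul_one_div]
      _ ≤ 2 * q ^ (n ^ 2 - 1) / q ^ (n ^ 2 - 1 + 1) := by
          gcongr
          linarith
      _ = 2 / q := by
          rw [pow_succ q]
          field_simp
  calc ∑ i ∈ D.nontriv, (D.d i : ℝ) ^ 2 * (‖D.w i x‖ ^ t) ^ 2
      ≤ ∑ i ∈ D.nontriv, (D.d i : ℝ) ^ 2 *
          (8 ^ (4 * n + 6) * (|α i| ^ (4 * n + 6) + ε ^ (4 * n + 6))) :=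
        Finset.sum_le_sum fun i _ => mul_le_mul_of_nonneg_left (hterm i) (sq_nonneg _)
    _ = 8 ^ (4 * n + 6) * (∑ i ∈ D.nontriv, (D.d i : ℝ) ^ 2 * |α i| ^ (4 * n + 6) +
          ∑ i ∈ D.nontriv, (D.d i : ℝ) ^ 2 * ε ^ (4 * n + 6)) := by
        rw [← Finset.sum_add_distrib, Finset.mul_sum]
        exact Finset.sum_congr rfl fun i _ => by ring
    _ ≤ 8 ^ (4 * n + 6) * (64 * 256 ^ n * C ^ 3 / q + 2 / q) := by gcongr
    _ = _ := by ring

end UnitaryDual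

namespace Matrix.SpecialLinearGroup

/-- Noncentral elements of `SL₂` have a cyclic covector. -/
theorem exists_cyclic_of_two {F : Type*} [Field F] {x : SpecialLinearGroup (Fin 2) F}
    (hx : x ∉ Subgroup.center (SpecialLinearGroup (Fin 2) F)) :
    ∃ ψ : Fin 2 → F, ∀ b, (∀ k : ℕ, ψ ⬝ᵥ ((x ^ k).1 *ᵥ b) = 0) → b = 0 := by
  obtain ⟨ψ, hψ⟩ := exists_linearIndependent_vecMul hx
  refine ⟨ψ, fun b hb => ?_⟩
  by_contra hb0
  have h0 : b ⬝ᵥ ψ = 0 := by simpa [dotProduct_comm] using hb 0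
  have h1 : b ⬝ᵥ (ψ ᵥ* x.1) = 0 := by
    rw [dotProduct_comm, ← dotProduct_mulVec]
    simpa using hb 1
  have hspan : Submodule.span F (Set.range ![ψ, ψ ᵥ* x.1]) = ⊤ :=
    hψ.span_eq_top_of_card_eq_finrank' (by simp)
  obtain ⟨χ, hχ⟩ := exists_dotProduct_eq_one hb0
  have hle : Submodule.span F (Set.range ![ψ, ψ ᵥ* x.1]) ≤ rowKer b := by
    rw [Submodule.span_le]
    rintro _ ⟨j, rfl⟩
    refine mem_rowKer.mpr ?_
    fin_cases j
    exacts [h0, h1]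
  have := mem_rowKer.mp (hle (hspan ▸ Submodule.mem_top : χ ∈ _))
  rw [dotProduct_comm, hχ] at this
  exact one_ne_zero this

end Matrix.SpecialLinearGroup

/-- Corollary 1.12(ii). For every `n ≥ 2` there exists `Q(n)`
such that for every finite field `𝔽_q` with `q ≥ Q(n)`, every non-central
element `x` of `G = SL_n(𝔽_q)` and every `t ≥ 2n + 3`, the random walk driven
by the conjugacy class `C = x^G` satisfies `‖P^t − U‖₁ < 1/e`; in particular the
mixing time `T(G, x)` is at most `2n + 3` for all sufficiently large `q`. -/
theorem mixing_time_noncentral_SL (n : ℕ) (hn : 2 ≤ n) :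
    ∃ Q : ℕ, ∀ (F : Type) [Field F] [Fintype F] [DecidableEq F],
      Q ≤ Fintype.card F →
      ∀ x : Matrix.SpecialLinearGroup (Fin n) F,
        x ∉ Subgroup.center (Matrix.SpecialLinearGroup (Fin n) F) →
        ∀ t : ℕ, 2 * n + 3 ≤ t →
          walkL1Dist
              {z : Matrix.SpecialLinearGroup (Fin n) F | ∃ c, c * x * c⁻¹ = z} t <
            1 / Real.exp 1 := by
  set K : ℕ := 8 ^ (4 * n + 6) * (64 * 256 ^ n * (32 * 16 ^ n) ^ 3 + 2) +
    (32 * n) ^ (2 * n + 3) with hK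
  refine ⟨16 * K, fun F _ _ _ hQ x hx t ht => ?_⟩
  obtain ⟨D⟩ := nonempty_unitaryDual (Matrix.SpecialLinearGroup (Fin n) F)
  have hq : (0 : ℝ) < Fintype.card F := by exact_mod_cast Fintype.card_pos
  have hQ' : 16 * (K : ℝ) ≤ Fintype.card F := by exact_mod_cast hQ
  have hKr : (K : ℝ) = 8 ^ (4 * n + 6) * (64 * 256 ^ n * (32 * 16 ^ n) ^ 3 + 2) +
      (32 * n) ^ (2 * n + 3) := by
    rw [hK]
    push_cast
    rfl
  have hbound : ∑ i ∈ D.nontriv, (D.d i : ℝ) ^ 2 * (‖D.w i x‖ ^ t) ^ 2 ≤ K / Fintype.card F := by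
    by_cases hcyc : ∃ ψ : Fin n → F, ∀ b, (∀ k : ℕ, ψ ⬝ᵥ ((x ^ k).1.mulVec b) = 0) → b = 0
    · obtain ⟨ψ, hψ⟩ := hcyc
      refine (D.sum_nontriv_le_of_cyclic hn hψ ht).trans ?_
      gcongr
      rw [hKr]
      exact le_add_of_nonneg_left (by positivity)
    · rcases hn.eq_or_lt with rfl | h3
      · exact absurd (Matrix.SpecialLinearGroup.exists_cyclic_of_two hx) hcyc
      · push Not at hcyc
        refine (D.sum_nontriv_le_of_not_cyclic h3 hx
          (fun ψ => (hcyc ψ).imp fun b hb => ⟨hb.2, hb.1⟩) ht).trans ?_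
        gcongr
        rw [hKr]
        exact le_add_of_nonneg_right (by positivity)
  have h16 : (K : ℝ) / Fintype.card F ≤ 1 / 16 := by
    rw [div_le_iff₀ hq]
    linarith
  have hsq := (D.walkL1Dist_sq_le x t).trans (hbound.trans h16)
  have h4 := abs_le_of_sq_le_sq (hsq.trans (by norm_num : (1 : ℝ) / 16 ≤ (1 / 4) ^ 2)) (by norm_num)
  refine lt_of_le_of_lt (le_of_abs_le h4) (one_div_lt_one_div_of_lt (Real.exp_pos 1) ?_)
  linarith [Real.exp_one_lt_d9]
end
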